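/- (Main distribution theorem.) Let σ ∈ Σ = {1, b, b·c·b, b·a·c·b, b·c·a·b·a·c·b} and let R = Q3ᵀ·σ·Q3 (which satisfies Rᵀ = R and Sᵀ·R·S = R). Then every (S,ψ,T)-invariant distribution T on R is transpose-invariant: T(x ↦ f(xᵀ)) = T(f) for all f ∈ C_c^∞(R). -/

import Mathlib

open Matrix Pointwise

/-- 2×2 matrices over `k`. -/
abbrev M2 (k : Type*) [Field k] := Matrix (Fin 2) (Fin 2) k

/-- 6×6 matrices over `k`. -/
abbrev M6 (k : Type*) [Field k] := Matrix (Fin 6) (Fin 6) k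

variable {k : Type*} [Field k]

/-- The 2×2 matrix `J = [[0,-1],[1,0]]`. -/
def Jmat : M2 k := !![0, -1; 1, 0]

/-- Build a 6×6 matrix from a 3×3 array of 2×2 blocks. -/
def blk (M : Fin 3 → Fin 3 → M2 k) : M6 k :=
  Matrix.of fun i j =>
    M ⟨i.val / 2, by have := i.isLt; omega⟩ ⟨j.val / 2, by have := j.isLt; omega⟩
      ⟨i.val % 2, by have := i.isLt; omega⟩ ⟨j.val % 2, by have := j.isLt; omega⟩

/-- Block diagonal 6×6 matrix with 2×2 blocks `g`, `h`, `m`. -/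
def bdiag (g h m : M2 k) : M6 k := blk ![![g, 0, 0], ![0, h, 0], ![0, 0, m]]

/-- The block upper unitriangular matrix `[[I,X,Z],[0,I,Y],[0,0,I]]`. -/
def Umat (X Y Z : M2 k) : M6 k := blk ![![1, X, Z], ![0, 1, Y], ![0, 0, 1]]

/-- The 6×6 matrix `J3` with 2×2 blocks `[[0,0,J],[0,J,0],[J,0,0]]`. -/
def J3 : M6 k := blk ![![0, 0, Jmat], ![0, Jmat, 0], ![Jmat, 0, 0]]

/-- The group of symplectic similitudes `GSp6(k)`, as a subset of the 6×6 matrices. -/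
def GSp6 (k : Type*) [Field k] : Set (M6 k) :=
  {g | IsUnit g ∧ ∃ l : kˣ, g * J3 * gᵀ = (l : k) • (J3 : M6 k)}

/-- The Levi subgroup `L3 = { blockdiag(g, h, det(g⁻¹h)·g) }`. -/
def L3 (k : Type*) [Field k] : Set (M6 k) :=
  {m | ∃ g h : M2 k, IsUnit g ∧ IsUnit h ∧ m = bdiag g h ((g⁻¹ * h).det • g)}

/-- The unipotent radical `U3`. -/
def U3 (k : Type*) [Field k] : Set (M6 k) :=
  {m | ∃ X Y Z : M2 k, X * Jmat + Jmat * Yᵀ = 0 ∧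
    Z * Jmat + Jmat * Zᵀ = -(X * Jmat * Xᵀ) ∧ m = Umat X Y Z}

/-- The parabolic subgroup `Q3 = L3 · U3`. -/
def Q3 (k : Type*) [Field k] : Set (M6 k) := L3 k * U3 k

/-- The diagonal embedding `Δ(g) = blockdiag(g,g,g)`. -/
def Dmat (g : M2 k) : M6 k := bdiag g g g

/-- The diagonal copy `Δ(GL2)` of `GL2` in `GSp6`. -/
def DeltaGL2 (k : Type*) [Field k] : Set (M6 k) := {m | ∃ g : M2 k, IsUnit g ∧ m = Dmat g}

/-- The embedding `η(g) = blockdiag(I, g, det(g)·I)`. -/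
def etaMat (g : M2 k) : M6 k := bdiag 1 g (g.det • (1 : M2 k))

/-- The copy `η(GL2)` of `GL2` in `GSp6`. -/
def etaGL2 (k : Type*) [Field k] : Set (M6 k) := {m | ∃ g : M2 k, IsUnit g ∧ m = etaMat g}

/-- The Shalika subgroup `S = Δ(GL2) · U3`. -/
def Sgrp (k : Type*) [Field k] : Set (M6 k) := DeltaGL2 k * U3 k

/-- For a subset `H` of the 6×6 matrices, `Hᵀ = { hᵀ : h ∈ H }`. -/
def setT (H : Set (M6 k)) : Set (M6 k) := Matrix.transpose '' H

/-- The Weyl element `a = blockdiag(J, I, J)`. -/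
def amat : M6 k := bdiag Jmat 1 Jmat

/-- The Weyl element `c = blockdiag(I, J, I)`. -/
def cmat : M6 k := bdiag 1 Jmat 1

/-- The Weyl element `b`. -/
def bmat : M6 k :=
  !![1,0,0,0,0,0; 0,0,1,0,0,0; 0,-1,0,0,0,0; 0,0,0,0,1,0; 0,0,0,-1,0,0; 0,0,0,0,0,1]

/-- The set `Σ = {1, b, b·c·b, b·a·c·b, b·c·a·b·a·c·b}` of double coset representatives. -/
def SigmaSet (k : Type*) [Field k] : Set (M6 k) :=
  {1, bmat, bmat * cmat * bmat, bmat * amat * cmat * bmat,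
    bmat * cmat * amat * bmat * amat * cmat * bmat}

/-- The space `C_c^∞(X)` of locally constant, compactly supported functions `X → ℂ`, for a
subset `X` of the 6×6 matrices over a topological field. -/
def Cc {k : Type*} [Field k] [TopologicalSpace k] (X : Set (M6 k)) :
    Set ({m : M6 k // m ∈ X} → ℂ) :=
  {f | IsLocallyConstant f ∧ HasCompactSupport f}

/-- An `(S,ψ,T)`-invariant distribution on a subset `X ⊆ GSp6(k)` with `Sᵀ·X·S = X`: a
`ℂ`-linear functional `T` on `C_c^∞(X)` such that `T(x ↦ f(s⁻¹·x·t)) = ψ_Sᵀ(s)·ψ_S(t)⁻¹·T(f)`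
for all `s ∈ Sᵀ` and `t ∈ S`.  (The values of `T` outside `C_c^∞(X)` are irrelevant.) -/
def IsInvariantDistrib {k : Type*} [Field k] [TopologicalSpace k]
    (ψS : M6 k → ℂˣ) (X : Set (M6 k)) (T : ({m : M6 k // m ∈ X} → ℂ) → ℂ) : Prop :=
  (∀ f g, f ∈ Cc X → g ∈ Cc X → T (f + g) = T f + T g) ∧
  (∀ (c : ℂ) f, f ∈ Cc X → T (c • f) = c * T f) ∧
  (∀ s ∈ setT (Sgrp k), ∀ t ∈ Sgrp k, ∀ f f', f ∈ Cc X → f' ∈ Cc X →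
    (∀ (x : M6 k) (hx : x ∈ X) (hx' : s⁻¹ * x * t ∈ X),
      f' ⟨x, hx⟩ = f ⟨s⁻¹ * x * t, hx'⟩) →
    T f' = (ψS sᵀ : ℂ) * (ψS t : ℂ)⁻¹ * T f)

/-- The defining properties of the Shalika character `ψ_S` (extended arbitrarily to all 6×6
matrices; only its values on `S` matter): it is multiplicative on `S`, equals
`ψ_k(−tr X)` on `U3`, and equals `1` on `Δ(GL2)`. -/
def IsShalikaCharacter {k : Type*} [Field k] (ψk : k → ℂˣ) (ψS : M6 k → ℂˣ) : Prop :=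
  (∀ x ∈ Sgrp k, ∀ y ∈ Sgrp k, ψS (x * y) = ψS x * ψS y) ∧
  (∀ X Y Z : M2 k, X * Jmat + Jmat * Yᵀ = 0 →
    Z * Jmat + Jmat * Zᵀ = -(X * Jmat * Xᵀ) → ψS (Umat X Y Z) = ψk (-(X.trace))) ∧
  (∀ g : M2 k, IsUnit g → ψS (Dmat g) = 1)

open Topology

section TestFunctions

variable {X : Type*} [TopologicalSpace X]

/-- Locally constant compactly supported functions, as a submodule of all functions. -/
def testFun (X : Type*) [TopologicalSpace X] : Submodule ℂ (X → ℂ) where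
  carrier := {f | IsLocallyConstant f ∧ HasCompactSupport f}
  add_mem' := fun hf hg => ⟨hf.1.add hg.1, hf.2.add hg.2⟩
  zero_mem' := ⟨IsLocallyConstant.const 0, HasCompactSupport.zero⟩
  smul_mem' := fun c _ hf => ⟨hf.1.comp (fun z => c • z), hf.2.smul_left (f := fun _ => c)⟩

theorem comp_homeomorph_mem_testFun {f : X → ℂ} (hf : f ∈ testFun X) (e : X ≃ₜ X) :
    (fun x => f (e x)) ∈ testFun X :=
  ⟨hf.1.comp_continuous e.continuous, hf.2.comp_homeomorph e⟩

theorem isClopen_support_of_mem_testFun {f : X → ℂ} (hf : f ∈ testFun X) :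
    IsClopen {x | f x ≠ 0} := by
  have h := hf.1 {z : ℂ | z ≠ 0}
  have h' := hf.1 {z : ℂ | z = 0}
  refine ⟨⟨?_⟩, h⟩
  convert h' using 1
  ext x
  simp

theorem isCompact_support_of_mem_testFun {f : X → ℂ} (hf : f ∈ testFun X) :
    IsCompact {x | f x ≠ 0} :=
  hf.2.isCompact.of_isClosed_subset (isClopen_support_of_mem_testFun hf).1 subset_closure

theorem mem_testFun_of {f : X → ℂ} (h1 : IsLocallyConstant f) {C : Set X} (hC : IsCompact C)
    (hC' : IsClosed C) (h : ∀ x, f x ≠ 0 → x ∈ C) : f ∈ testFun X :=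
  ⟨h1, hC.of_isClosed_subset (isClosed_tsupport f) (closure_minimal h hC')⟩

theorem indicator_mem_testFun {f : X → ℂ} (hf : f ∈ testFun X) {W : Set X} (hW : IsClopen W) :
    W.indicator f ∈ testFun X := by
  classical
  have h1 : IsLocallyConstant (W.indicator f) := by
    rw [IsLocallyConstant.iff_exists_open]
    intro x
    obtain ⟨U, hU, hx, h⟩ := (IsLocallyConstant.iff_exists_open f).1 hf.1 x
    by_cases hxW : x ∈ W
    · exact ⟨U ∩ W, hU.inter hW.2, ⟨hx, hxW⟩, fun y hy => by
        rw [Set.indicator_of_mem hy.2, Set.indicator_of_mem hxW, h y hy.1]⟩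
    · exact ⟨Wᶜ, hW.1.isOpen_compl, hxW, fun y hy => by
        rw [Set.indicator_of_notMem hy, Set.indicator_of_notMem hxW]⟩
  refine mem_testFun_of h1 (isCompact_support_of_mem_testFun hf)
    (isClopen_support_of_mem_testFun hf).1 fun x hx => ?_
  by_cases hxW : x ∈ W
  · rwa [Set.indicator_of_mem hxW] at hx
  · exact absurd (Set.indicator_of_notMem hxW f) hx

/-- The functional `T` vanishes on test functions supported near `x`. -/
def VanishesNear (T : testFun X →ₗ[ℂ] ℂ) (x : X) : Prop :=
  ∃ V ∈ 𝓝 x, ∀ f : testFun X, (∀ y, f.1 y ≠ 0 → y ∈ V) → T f = 0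

theorem eq_zero_of_vanishesNear_support [T2Space X] [LocallyCompactSpace X]
    [TotallyDisconnectedSpace X] (T : testFun X →ₗ[ℂ] ℂ) (f : testFun X)
    (h : ∀ x, f.1 x ≠ 0 → VanishesNear T x) : T f = 0 := by
  classical
  have key : ∃ W : Set X, IsClopen W ∧ {x | f.1 x ≠ 0} ⊆ W ∧
      ∀ g : testFun X, (∀ y, g.1 y ≠ 0 → y ∈ W) → T g = 0 := by
    refine (isCompact_support_of_mem_testFun f.2).induction_on (p := fun s =>
      ∃ W : Set X, IsClopen W ∧ s ⊆ W ∧ ∀ g : testFun X, (∀ y, g.1 y ≠ 0 → y ∈ W) → T g = 0)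
      ?_ ?_ ?_ ?_
    · refine ⟨∅, isClopen_empty, subset_rfl, fun g hg => ?_⟩
      have : g = 0 := by
        ext y
        by_contra hy
        exact hg y hy
      rw [this, map_zero]
    · rintro s t hst ⟨W, h1, h2, h3⟩
      exact ⟨W, h1, hst.trans h2, h3⟩
    · rintro s t ⟨W, h1, h2, h3⟩ ⟨W', h1', h2', h3'⟩
      refine ⟨W ∪ W', h1.union h1', Set.union_subset_union h2 h2', fun g hg => ?_⟩
      have e : g = ⟨W.indicator g.1, indicator_mem_testFun g.2 h1⟩ +
          ⟨Wᶜ.indicator g.1, indicator_mem_testFun g.2 h1.compl⟩ := by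
        ext y
        exact (congrFun (Set.indicator_self_add_compl W g.1) y).symm
      rw [e, map_add, h3, h3', add_zero]
      · intro y hy
        have hy' : y ∈ Wᶜ := Set.mem_of_indicator_ne_zero hy
        have : g.1 y ≠ 0 := by
          intro h0
          exact hy (by simp [Set.indicator, h0])
        exact (hg y this).resolve_left hy'
      · intro y hy
        exact Set.mem_of_indicator_ne_zero hy
    · intro x hx
      obtain ⟨V, hV, hT⟩ := h x hx
      obtain ⟨W, hW, hxW, hWV⟩ := (loc_compact_Haus_tot_disc_of_zero_dim (H := X)).mem_nhds_iff.1 hV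
      exact ⟨W, mem_nhdsWithin_of_mem_nhds (hW.2.mem_nhds hxW), W, hW, subset_rfl,
        fun g hg => hT g fun y hy => hWV (hg y hy)⟩
  obtain ⟨W, -, h2, h3⟩ := key
  exact h3 f h2

theorem vanishesNear_of_homeomorph {T : testFun X →ₗ[ℂ] ℂ} (e : X ≃ₜ X) (c : ℂ)
    (he : ∀ f f' : testFun X, (∀ x, f'.1 x = f.1 (e x)) → c * T f = T f') (hc : c ≠ 0) {x : X}
    (hx : VanishesNear T x) : VanishesNear T (e x) := by
  obtain ⟨V, hV, h⟩ := hx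
  refine ⟨e.symm ⁻¹' V, e.symm.continuous.continuousAt.preimage_mem_nhds (by simpa using hV),
    fun f hf => ?_⟩
  have h1 := h ⟨_, comp_homeomorph_mem_testFun f.2 e⟩ fun y hy => by
    simpa using hf (e y) hy
  have h2 := he f ⟨_, comp_homeomorph_mem_testFun f.2 e⟩ fun _ => rfl
  rw [h1] at h2
  exact (mul_eq_zero.1 h2).resolve_left hc

end TestFunctions

section Averaging

variable {X : Type*} [TopologicalSpace X] {K : Type*} [Group K] [TopologicalSpace K]
  [IsTopologicalGroup K] [MulAction K X] [ContinuousSMul K X]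

theorem isOpen_stabilizer_testFun {f : X → ℂ} (hf : f ∈ testFun X) :
    ∃ H : Subgroup K, IsOpen (H : Set K) ∧ ∀ k ∈ H, ∀ x, f (k • x) = f x := by
  let H : Subgroup K :=
    { carrier := {k | ∀ x, f (k • x) = f x}
      mul_mem' := fun {a b} ha hb x => by rw [mul_smul, ha, hb]
      one_mem' := fun x => by rw [one_smul]
      inv_mem' := fun {a} ha x => by rw [← ha (a⁻¹ • x), smul_inv_smul] }
  refine ⟨H, ?_, fun k hk => hk⟩
  let O : Set (K × X) := {p | f (p.1 • p.2) = f p.2}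
  have hO : IsOpen O := by
    have h1 : IsLocallyConstant (fun p : K × X => f (p.1 • p.2)) :=
      hf.1.comp_continuous continuous_smul
    have h2 : IsLocallyConstant (fun p : K × X => f p.2) := hf.1.comp_continuous continuous_snd
    exact (h1.prodMk h2) {z | z.1 = z.2}
  obtain ⟨U, V, hU, -, h1U, hCV, hUV⟩ := generalized_tube_lemma (isCompact_singleton (x := (1 : K)))
    (isCompact_support_of_mem_testFun hf) hO (by
      rintro ⟨k, x⟩ ⟨hk, -⟩
      rw [Set.mem_singleton_iff] at hk
      simp only at hk
      subst hk
      change f ((1 : K) • x) = f x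
      rw [one_smul])
  have h1 : ∀ k ∈ U, ∀ x, f x ≠ 0 → f (k • x) = f x := fun k hk x hx =>
    hUV (Set.mk_mem_prod hk (hCV hx))
  refine H.isOpen_of_mem_nhds (g := 1) ?_
  have hU1 : U ∈ 𝓝 (1 : K) := hU.mem_nhds (h1U rfl)
  have hU2 : U⁻¹ ∈ 𝓝 (1 : K) := inv_mem_nhds_one K hU1
  filter_upwards [hU1, hU2] with k hk hk' x
  by_cases hx : f x = 0
  · by_contra hne
    rw [hx] at hne
    have := h1 k⁻¹ hk' (k • x) hne
    rw [inv_smul_smul, hx] at this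
    exact hne this.symm
  · exact h1 k hk x hx

theorem exists_average [CompactSpace K] (χ : K →* ℂˣ) (hχ : IsOpen (χ.ker : Set K))
    (f : testFun X) :
    ∃ (F : testFun X) (n : ℕ), n ≠ 0 ∧ (∀ k x, F.1 (k • x) = χ k * F.1 x) ∧
      (∀ x, F.1 x ≠ 0 → ∃ k : K, f.1 (k • x) ≠ 0) ∧
      ∀ T : testFun X →ₗ[ℂ] ℂ,
        (∀ (k : K) (f f' : testFun X), (∀ x, f'.1 x = f.1 (k • x)) → T f' = χ k * T f) →
        T F = n * T f := by
  classical
  obtain ⟨H₀, hH₀, hfix₀⟩ := isOpen_stabilizer_testFun (K := K) f.2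
  let H := H₀ ⊓ χ.ker
  have hH : IsOpen (H : Set K) := by
    simpa [H, Subgroup.coe_inf] using hH₀.inter hχ
  have hfix : ∀ k ∈ H, ∀ x, f.1 (k • x) = f.1 x := fun k hk => hfix₀ k hk.1
  have hker : ∀ k ∈ H, χ k = 1 := fun k hk => hk.2
  have : Finite (K ⧸ H) := H.quotient_finite_of_isOpen hH
  have := Fintype.ofFinite (K ⧸ H)
  let t : K ⧸ H → X → ℂ := fun q => Quotient.liftOn' q
    (fun k x => (χ k : ℂ) * f.1 (k⁻¹ • x)) (by
      intro a b hab
      rw [QuotientGroup.leftRel_apply] at hab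
      funext x
      have h1 := hker _ hab
      have h2 := hfix _ hab (b⁻¹ • x)
      have h3 : χ b = χ a := by
        rw [map_mul, map_inv, inv_mul_eq_one] at h1
        exact h1.symm
      rw [← mul_smul, mul_assoc, mul_inv_cancel, mul_one] at h2
      simp only [h3, h2])
  have ht : ∀ (k : K) (x : X), t (k : K ⧸ H) x = (χ k : ℂ) * f.1 (k⁻¹ • x) := fun _ _ => rfl
  have htmem : ∀ q, t q ∈ testFun X := by
    intro q
    induction q using QuotientGroup.induction_on with
    | H k =>
      exact (testFun X).smul_mem (χ k : ℂ)
        (comp_homeomorph_mem_testFun f.2 (Homeomorph.smul (k⁻¹ : K)))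
  refine ⟨∑ q, ⟨t q, htmem q⟩, Fintype.card (K ⧸ H), Fintype.card_ne_zero, ?_, ?_, ?_⟩
  · intro k x
    simp only [AddSubmonoidClass.coe_finsetSum, Finset.sum_apply, Finset.mul_sum]
    rw [← Equiv.sum_comp (MulAction.toPerm k : Equiv.Perm (K ⧸ H))]
    refine Finset.sum_congr rfl fun q _ => ?_
    induction q using QuotientGroup.induction_on with
    | H j =>
      change t ((k * j : K) : K ⧸ H) (k • x) = (χ k : ℂ) * t (j : K ⧸ H) x
      rw [ht, ht, map_mul, _root_.mul_inv_rev, mul_smul, inv_smul_smul]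
      push_cast
      ring
  · intro x hx
    simp only [AddSubmonoidClass.coe_finsetSum, Finset.sum_apply] at hx
    obtain ⟨q, -, hq⟩ := Finset.exists_ne_zero_of_sum_ne_zero hx
    induction q using QuotientGroup.induction_on with
    | H j =>
      rw [ht] at hq
      exact ⟨j⁻¹, right_ne_zero_of_mul hq⟩
  · intro T hT
    rw [map_sum]
    have : ∀ q : K ⧸ H, T ⟨t q, htmem q⟩ = T f := by
      intro q
      induction q using QuotientGroup.induction_on with
      | H j =>
        have e : (⟨t (j : K ⧸ H), htmem _⟩ : testFun X) = (χ j : ℂ) •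
          ⟨_, comp_homeomorph_mem_testFun f.2 (Homeomorph.smul (j⁻¹ : K))⟩ := rfl
        rw [e, map_smul, hT j⁻¹ f _ fun _ => rfl, map_inv, smul_eq_mul, ← mul_assoc,
          Units.mul_inv, one_mul]
    rw [Finset.sum_congr rfl fun q _ => this q, Finset.sum_const, Finset.card_univ, nsmul_eq_mul]

/-- Vanishing criterion: an equivariant, `τ`-odd functional vanishes near a point if every
equivariant, `τ`-odd function vanishes at all nearby points of its support. -/
theorem vanishesNear_of_equivariant [T2Space X] [LocallyCompactSpace X]
    [TotallyDisconnectedSpace X] [CompactSpace K] (χ : K →* ℂˣ) (hχ : IsOpen (χ.ker : Set K))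
    (τ : X ≃ₜ X) (hττ : ∀ x, τ (τ x) = x) (θ : K → K) (hθ : ∀ k x, τ (k • x) = θ k • τ x)
    (hθχ : ∀ k, χ (θ k) = χ k) (T : testFun X →ₗ[ℂ] ℂ)
    (hT : ∀ (k : K) (f f' : testFun X), (∀ x, f'.1 x = f.1 (k • x)) → T f' = χ k * T f)
    (hTτ : ∀ f f' : testFun X, (∀ x, f'.1 x = f.1 (τ x)) → T f' = -T f) (x₀ : X)
    (hx₀ : ∀ᶠ x in 𝓝 x₀, VanishesNear T x ∨
      ∀ F : X → ℂ, (∀ k y, F (k • y) = χ k * F y) → (∀ y, F (τ y) = -F y) → F x = 0) :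
    VanishesNear T x₀ := by
  refine ⟨_, hx₀, fun f hf => ?_⟩
  obtain ⟨A, n, hn, hA, hAf, hAT⟩ := exists_average χ hχ f
  let A' : testFun X := ⟨_, comp_homeomorph_mem_testFun A.2 τ⟩
  have hA' : ∀ x, A'.1 x = A.1 (τ x) := fun _ => rfl
  let F := A - A'
  have hF : ∀ x, F.1 x = A.1 x - A.1 (τ x) := fun _ => rfl
  have hFk : ∀ k y, F.1 (k • y) = χ k * F.1 y := by
    intro k y
    rw [hF, hF, hθ, hA, hA, hθχ]
    ring
  have hFτ : ∀ y, F.1 (τ y) = -F.1 y := by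
    intro y
    rw [hF, hF, hττ]
    ring
  have hVτ : ∀ x, VanishesNear T (τ x) → VanishesNear T x := by
    intro x hx
    have := vanishesNear_of_homeomorph τ (-1) (fun f f' h => by rw [hTτ f f' h]; ring)
      (by norm_num) hx
    rwa [hττ] at this
  have hVk : ∀ (k : K) x, VanishesNear T (k • x) → VanishesNear T x := by
    intro k x hx
    have := vanishesNear_of_homeomorph (Homeomorph.smul k⁻¹) (χ k⁻¹ : ℂ)
      (fun f f' h => (hT k⁻¹ f f' h).symm) (Units.ne_zero _) hx
    simpa using this
  have hTF : T F = 0 := by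
    refine eq_zero_of_vanishesNear_support T F fun x hx => ?_
    have hcase : A.1 x ≠ 0 ∨ A.1 (τ x) ≠ 0 := by
      by_contra! h
      exact hx (by rw [hF, h.1, h.2, sub_zero])
    rcases hcase with h | h
    · obtain ⟨k, hk⟩ := hAf _ h
      refine hVk k x ((hf _ hk).resolve_right fun hh => ?_)
      have := hh F.1 hFk hFτ
      rw [hFk] at this
      exact mul_ne_zero (Units.ne_zero _) hx this
    · obtain ⟨k, hk⟩ := hAf _ h
      refine hVτ x (hVk k _ ((hf _ hk).resolve_right fun hh => ?_))
      have := hh F.1 hFk hFτ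
      rw [hFk, hFτ] at this
      exact mul_ne_zero (Units.ne_zero _) (neg_ne_zero.2 hx) this
  have e : T F = 2 * (n * T f) := by
    rw [map_sub, hTτ A A' hA', hAT T hT]
    ring
  rw [e] at hTF
  have hn' : (n : ℂ) ≠ 0 := Nat.cast_ne_zero.2 hn
  have h2 : (2 : ℂ) ≠ 0 := two_ne_zero
  simpa [hn', h2] using hTF

end Averaging

section Blocks

variable {F : Type*} [Field F]

/-- The `(i, j)` block of a 6×6 matrix. -/
def bk (m : M6 F) (i j : Fin 3) : M2 F :=
  Matrix.of fun a b => m ⟨2 * i.val + a.val, by omega⟩ ⟨2 * j.val + b.val, by omega⟩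

theorem bk_blk (M : Fin 3 → Fin 3 → M2 F) : bk (blk M) = M := by
  funext i j
  ext a b
  fin_cases i <;> fin_cases a <;> fin_cases j <;> fin_cases b <;> rfl

theorem blk_bk (m : M6 F) : blk (bk m) = m := by
  ext i j
  fin_cases i <;> fin_cases j <;> rfl

theorem bk_ext {m n : M6 F} (h : ∀ i j, bk m i j = bk n i j) : m = n := by
  rw [← blk_bk m, ← blk_bk n]
  congr 1
  funext i j
  exact h i j

theorem bk_mul (m n : M6 F) (i j : Fin 3) :
    bk (m * n) i j = bk m i 0 * bk n 0 j + bk m i 1 * bk n 1 j + bk m i 2 * bk n 2 j := by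
  ext a b
  simp only [bk, Matrix.of_apply, Matrix.mul_apply, Matrix.add_apply, Fin.sum_univ_six,
    Fin.sum_univ_two, ← add_assoc]
  rfl

theorem bk_transpose (m : M6 F) (i j : Fin 3) : bk mᵀ i j = (bk m j i)ᵀ := rfl

theorem bk_smul (c : F) (m : M6 F) (i j : Fin 3) : bk (c • m) i j = c • bk m i j := rfl

theorem bk_one (i j : Fin 3) : bk (1 : M6 F) i j = if i = j then 1 else 0 := by
  ext a b
  fin_cases i <;> fin_cases a <;> fin_cases j <;> fin_cases b <;> simp [bk]

theorem blk_mul (a b c d e f g h i a' b' c' d' e' f' g' h' i' : M2 F) :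
    blk ![![a, b, c], ![d, e, f], ![g, h, i]] * blk ![![a', b', c'], ![d', e', f'], ![g', h', i']] =
      blk ![![a * a' + b * d' + c * g', a * b' + b * e' + c * h', a * c' + b * f' + c * i'],
        ![d * a' + e * d' + f * g', d * b' + e * e' + f * h', d * c' + e * f' + f * i'],
        ![g * a' + h * d' + i * g', g * b' + h * e' + i * h', g * c' + h * f' + i * i']] := by
  apply bk_ext
  intro x y
  rw [bk_mul, bk_blk, bk_blk, bk_blk]
  fin_cases x <;> fin_cases y <;> rfl

theorem blk_transpose (a b c d e f g h i : M2 F) :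
    (blk ![![a, b, c], ![d, e, f], ![g, h, i]])ᵀ =
      blk ![![aᵀ, dᵀ, gᵀ], ![bᵀ, eᵀ, hᵀ], ![cᵀ, fᵀ, iᵀ]] := by
  apply bk_ext
  intro x y
  rw [bk_transpose, bk_blk, bk_blk]
  fin_cases x <;> fin_cases y <;> rfl

theorem blk_smul (t : F) (a b c d e f g h i : M2 F) :
    t • (blk ![![a, b, c], ![d, e, f], ![g, h, i]]) =
      blk ![![t • a, t • b, t • c], ![t • d, t • e, t • f], ![t • g, t • h, t • i]] := by
  apply bk_ext
  intro x y
  rw [bk_smul, bk_blk, bk_blk]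
  fin_cases x <;> fin_cases y <;> rfl

theorem blk_inj {a b c d e f g h i a' b' c' d' e' f' g' h' i' : M2 F} :
    blk ![![a, b, c], ![d, e, f], ![g, h, i]] = blk ![![a', b', c'], ![d', e', f'], ![g', h', i']] ↔
      (a = a' ∧ b = b' ∧ c = c') ∧ (d = d' ∧ e = e' ∧ f = f') ∧ (g = g' ∧ h = h' ∧ i = i') := by
  constructor
  · intro H
    have H' := congrArg bk H
    rw [bk_blk, bk_blk] at H'
    exact ⟨⟨congrFun (congrFun H' 0) 0, congrFun (congrFun H' 0) 1, congrFun (congrFun H' 0) 2⟩,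
      ⟨congrFun (congrFun H' 1) 0, congrFun (congrFun H' 1) 1, congrFun (congrFun H' 1) 2⟩,
      ⟨congrFun (congrFun H' 2) 0, congrFun (congrFun H' 2) 1, congrFun (congrFun H' 2) 2⟩⟩
  · rintro ⟨⟨rfl, rfl, rfl⟩, ⟨rfl, rfl, rfl⟩, rfl, rfl, rfl⟩
    rfl

theorem one_eq_blk : (1 : M6 F) = blk ![![1, 0, 0], ![0, 1, 0], ![0, 0, 1]] := by
  apply bk_ext
  intro x y
  rw [bk_one, bk_blk]
  fin_cases x <;> fin_cases y <;> rfl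

theorem exists_eq_blk (m : M6 F) : ∃ a b c d e f g h i : M2 F,
    m = blk ![![a, b, c], ![d, e, f], ![g, h, i]] := by
  refine ⟨bk m 0 0, bk m 0 1, bk m 0 2, bk m 1 0, bk m 1 1, bk m 1 2, bk m 2 0, bk m 2 1,
    bk m 2 2, ?_⟩
  apply bk_ext
  intro x y
  rw [bk_blk]
  fin_cases x <;> fin_cases y <;> rfl

theorem exists_eq_fin_two (m : M2 F) : ∃ a b c d : F, m = !![a, b; c, d] :=
  ⟨_, _, _, _, Matrix.eta_fin_two m⟩

theorem transpose_of_fin_two {R : Type*} (a b c d : R) : !![a, b; c, d]ᵀ = !![a, c; b, d] := by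
  ext i j
  fin_cases i <;> fin_cases j <;> rfl

theorem isUnit_iff_det_ne_zero {g : M2 F} : IsUnit g ↔ g.det ≠ 0 := by
  rw [Matrix.isUnit_iff_isUnit_det, isUnit_iff_ne_zero]

theorem J_transpose_eq (m : M2 F) : Jmat * mᵀ = m.adjugate * Jmat := by
  obtain ⟨a, b, c, d, rfl⟩ := exists_eq_fin_two m
  ext i j
  fin_cases i <;> fin_cases j <;> simp [Jmat, Matrix.adjugate_fin_two, transpose_of_fin_two]

theorem mul_Jmat_inj {a b : M2 F} : a * Jmat = b * Jmat ↔ a = b := by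
  have : IsUnit (Jmat : M2 F) := by
    rw [isUnit_iff_det_ne_zero]; simp [Jmat, Matrix.det_fin_two]
  exact this.mul_left_inj

theorem adjugate_smul_two (c : F) (g : M2 F) : (c • g).adjugate = c • g.adjugate := by
  simp [Matrix.adjugate_smul]

theorem adjugate_add_two (g h : M2 F) : (g + h).adjugate = g.adjugate + h.adjugate := by
  ext i j
  fin_cases i <;> fin_cases j <;> simp [Matrix.adjugate_fin_two, add_comm]

theorem adjugate_neg_two (g : M2 F) : (-g).adjugate = -g.adjugate := by
  ext i j
  fin_cases i <;> fin_cases j <;> simp [Matrix.adjugate_fin_two]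

theorem adjugate_adjugate_two (g : M2 F) : g.adjugate.adjugate = g := by
  ext i j
  fin_cases i <;> fin_cases j <;> simp [Matrix.adjugate_fin_two]

/-- The relation between the two entries next to the diagonal of an element of `U3`. -/
theorem mul_Jmat_add_eq_zero_iff {X Y : M2 F} :
    X * Jmat + Jmat * Yᵀ = 0 ↔ Y = -X.adjugate := by
  rw [J_transpose_eq, ← add_mul, ← zero_mul (Jmat : M2 F), mul_Jmat_inj, ← eq_neg_iff_add_eq_zero]
  constructor
  · rintro rfl; rw [adjugate_neg_two, adjugate_adjugate_two, neg_neg]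
  · rintro rfl; rw [adjugate_neg_two, adjugate_adjugate_two, neg_neg]

/-- The relation satisfied by the corner entry of an element of `U3`. -/
theorem mul_Jmat_add_eq_neg_iff {X Z : M2 F} :
    Z * Jmat + Jmat * Zᵀ = -(X * Jmat * Xᵀ) ↔ Z.trace = -X.det := by
  obtain ⟨a, b, c, d, rfl⟩ := exists_eq_fin_two X
  obtain ⟨a', b', c', d', rfl⟩ := exists_eq_fin_two Z
  rw [← Matrix.ext_iff]
  simp [Jmat, Matrix.det_fin_two, Matrix.trace_fin_two, Fin.forall_fin_two, transpose_of_fin_two]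
  constructor <;> intro h <;> grind

end Blocks

section Parabolic

variable {F : Type*} [Field F]

theorem umat_mem_U3 {X Z : M2 F} (h : Z.trace = -X.det) : Umat X (-X.adjugate) Z ∈ U3 F :=
  ⟨X, _, Z, mul_Jmat_add_eq_zero_iff.2 rfl, mul_Jmat_add_eq_neg_iff.2 h, rfl⟩

theorem mem_U3_iff {m : M6 F} :
    m ∈ U3 F ↔ ∃ X Z : M2 F, Z.trace = -X.det ∧ m = Umat X (-X.adjugate) Z := by
  constructor
  · rintro ⟨X, Y, Z, h1, h2, rfl⟩
    rw [mul_Jmat_add_eq_zero_iff] at h1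
    rw [mul_Jmat_add_eq_neg_iff] at h2
    exact ⟨X, Z, h2, by rw [h1]⟩
  · rintro ⟨X, Z, h, rfl⟩
    exact umat_mem_U3 h

theorem mem_Sgrp_iff {m : M6 F} : m ∈ Sgrp F ↔ ∃ g X Z : M2 F, g.det ≠ 0 ∧
    Z.trace = -X.det ∧ m = Dmat g * Umat X (-X.adjugate) Z := by
  constructor
  · rintro ⟨_, ⟨g, hg, rfl⟩, u, hu, rfl⟩
    obtain ⟨X, Z, h, rfl⟩ := mem_U3_iff.1 hu
    exact ⟨g, X, Z, isUnit_iff_det_ne_zero.1 hg, h, rfl⟩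
  · rintro ⟨g, X, Z, hg, h, rfl⟩
    exact Set.mul_mem_mul ⟨g, isUnit_iff_det_ne_zero.2 hg, rfl⟩ (umat_mem_U3 h)

theorem det_inv_mul {g h : M2 F} : (g⁻¹ * h).det = h.det / g.det := by
  rw [Matrix.det_mul, Matrix.det_nonsing_inv, Ring.inverse_eq_inv', div_eq_inv_mul]

theorem mem_Q3_iff {m : M6 F} : m ∈ Q3 F ↔ ∃ g h X Z : M2 F, g.det ≠ 0 ∧ h.det ≠ 0 ∧
    Z.trace = -X.det ∧
    m = bdiag g h ((h.det / g.det) • g) * Umat X (-X.adjugate) Z := by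
  constructor
  · rintro ⟨_, ⟨g, h, hg, hh, rfl⟩, u, hu, rfl⟩
    obtain ⟨X, Z, hXZ, rfl⟩ := mem_U3_iff.1 hu
    exact ⟨g, h, X, Z, isUnit_iff_det_ne_zero.1 hg, isUnit_iff_det_ne_zero.1 hh, hXZ, by
      rw [det_inv_mul]⟩
  · rintro ⟨g, h, X, Z, hg, hh, hXZ, rfl⟩
    exact Set.mul_mem_mul ⟨g, h, isUnit_iff_det_ne_zero.2 hg, isUnit_iff_det_ne_zero.2 hh, by
      rw [det_inv_mul]⟩ (umat_mem_U3 hXZ)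

/-- The adjoint of a 6×6 matrix for the form `J3`. -/
def sympAdj (m : M6 F) : M6 F := blk fun i j => (bk m (2 - j) (2 - i)).adjugate

theorem bk_sympAdj (m : M6 F) (i j : Fin 3) :
    bk (sympAdj m) i j = (bk m (2 - j) (2 - i)).adjugate := by
  rw [sympAdj, bk_blk]

theorem sympAdj_sympAdj (m : M6 F) : sympAdj (sympAdj m) = m := by
  apply bk_ext
  intro i j
  rw [bk_sympAdj, bk_sympAdj, adjugate_adjugate_two]
  fin_cases i <;> fin_cases j <;> rfl

theorem sympAdj_mul (m n : M6 F) : sympAdj (m * n) = sympAdj n * sympAdj m := by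
  apply bk_ext
  intro i j
  simp only [bk_sympAdj, bk_mul, adjugate_add_two, Matrix.adjugate_mul_distrib]
  have h0 : (2 - 0 : Fin 3) = 2 := rfl
  have h1 : (2 - 1 : Fin 3) = 1 := rfl
  have h2 : (2 - 2 : Fin 3) = 0 := rfl
  rw [h0, h1, h2]
  abel

theorem sympAdj_smul (c : F) (m : M6 F) : sympAdj (c • m) = c • sympAdj m := by
  apply bk_ext
  intro i j
  simp only [bk_sympAdj, bk_smul, adjugate_smul_two]

theorem sympAdj_blk (a b c d e f g h i : M2 F) :
    sympAdj (blk ![![a, b, c], ![d, e, f], ![g, h, i]]) =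
      blk ![![i.adjugate, f.adjugate, c.adjugate], ![h.adjugate, e.adjugate, b.adjugate],
        ![g.adjugate, d.adjugate, a.adjugate]] := by
  apply bk_ext
  intro x y
  rw [bk_sympAdj, bk_blk, bk_blk]
  fin_cases x <;> fin_cases y <;> rfl

theorem two_mul_adjugate_eq_trace (Z : M2 F) : Z + Z.adjugate = Z.trace • (1 : M2 F) := by
  ext i j
  fin_cases i <;> fin_cases j <;> simp [Matrix.adjugate_fin_two, Matrix.trace_fin_two, add_comm]

/-- Equational description of the parabolic subgroup. -/
theorem mem_Q3_iff_sympAdj {m : M6 F} : m ∈ Q3 F ↔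
    (bk m 1 0 = 0 ∧ bk m 2 0 = 0 ∧ bk m 2 1 = 0) ∧ (bk m 1 1).det ≠ 0 ∧
      m * sympAdj m = (bk m 1 1).det • (1 : M6 F) := by
  rw [mem_Q3_iff]
  constructor
  · rintro ⟨g, h, X, Z, hg, hh, hXZ, rfl⟩
    rw [bdiag, Umat, blk_mul]
    simp only [zero_mul, mul_zero, add_zero, zero_add, mul_one, bk_blk]
    refine ⟨⟨rfl, rfl, rfl⟩, hh, ?_⟩
    change _ = h.det • (1 : M6 F)
    rw [sympAdj_blk, blk_mul, one_eq_blk, blk_smul, blk_inj]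
    have e1 : g * g.adjugate = g.det • (1 : M2 F) := Matrix.mul_adjugate g
    have e2 : h * h.adjugate = h.det • (1 : M2 F) := Matrix.mul_adjugate h
    have e3 : X * X.adjugate = X.det • (1 : M2 F) := Matrix.mul_adjugate X
    have e4 := two_mul_adjugate_eq_trace Z
    have e5 : h.det / g.det * g.det = h.det := div_mul_cancel₀ _ hg
    have hs : ∀ c : F, (c • g).adjugate = c • g.adjugate := fun c => adjugate_smul_two c g
    simp only [zero_mul, mul_zero, add_zero, zero_add, Matrix.adjugate_zero, smul_zero, hs,
      Matrix.adjugate_mul_distrib, adjugate_neg_two, mul_neg, adjugate_adjugate_two,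
      Matrix.smul_mul, Matrix.mul_smul, e1, e2, smul_smul, e5, true_and, and_true]
    refine ⟨⟨?_, ?_⟩, ?_⟩
    · rw [mul_assoc, neg_add_cancel]
    · have : g * (Z.adjugate * g.adjugate) + g * X * (X.adjugate * g.adjugate) + g * Z * g.adjugate
          = g * ((Z + Z.adjugate) + X * X.adjugate) * g.adjugate := by noncomm_ring
      rw [this, e4, e3, ← add_smul, hXZ, neg_add_cancel, zero_smul, mul_zero, zero_mul]
    · refine ⟨⟨by rw [neg_zero, zero_add], ?_⟩, neg_zero⟩
      rw [neg_mul, mul_assoc, add_neg_cancel]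
  · rintro ⟨⟨h1, h2, h3⟩, hh, h4⟩
    obtain ⟨g, A, B, d, h, C, e, f, n, rfl⟩ := exists_eq_blk m
    simp only [bk_blk] at h1 h2 h3 hh h4
    change d = 0 at h1
    change e = 0 at h2
    change f = 0 at h3
    change h.det ≠ 0 at hh
    subst h1 h2 h3
    change _ = h.det • (1 : M6 F) at h4
    rw [sympAdj_blk, blk_mul, one_eq_blk, blk_smul, blk_inj] at h4
    simp only [zero_mul, mul_zero, add_zero, zero_add, Matrix.adjugate_zero, smul_zero,
      true_and] at h4
    obtain ⟨⟨ha, hb, hc⟩, -⟩ := h4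
    have hg : g.det ≠ 0 := by
      intro h0
      have := congrArg Matrix.det ha
      rw [Matrix.det_mul, h0, zero_mul, Matrix.det_smul, Matrix.det_one, mul_one] at this
      exact hh (pow_eq_zero_iff (by simp) |>.1 this.symm)
    have hgu : IsUnit g.det := isUnit_iff_ne_zero.2 hg
    have hgi : g.adjugate * g = g.det • (1 : M2 F) := Matrix.adjugate_mul g
    have hgi' : g * g⁻¹ = 1 := Matrix.mul_nonsing_inv g hgu
    have hgi'' : g⁻¹ * g = 1 := Matrix.nonsing_inv_mul g hgu
    have hn : n = (h.det / g.det) • g := by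
      have h5 : g.adjugate * (g * n.adjugate) = g.adjugate * (h.det • (1 : M2 F)) := by rw [ha]
      rw [← mul_assoc, hgi, Matrix.smul_mul, one_mul, Matrix.mul_smul, mul_one] at h5
      have h6 := congrArg Matrix.adjugate h5
      rw [adjugate_smul_two, adjugate_smul_two, adjugate_adjugate_two, adjugate_adjugate_two] at h6
      rw [div_eq_inv_mul, mul_smul, ← h6, smul_smul, inv_mul_cancel₀ hg, one_smul]
    have hA : A = g * (g⁻¹ * A) := by rw [← mul_assoc, hgi', one_mul]
    have hB : B = g * (g⁻¹ * B) := by rw [← mul_assoc, hgi', one_mul]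
    generalize g⁻¹ * A = X at hA
    generalize g⁻¹ * B = Z at hB
    subst hA hB hn
    refine ⟨g, h, X, Z, hg, hh, ?_, ?_⟩
    · have e : g * (g * Z).adjugate + g * X * (g * X).adjugate + g * Z * g.adjugate
          = g * ((Z + Z.adjugate) + X * X.adjugate) * g.adjugate := by
        rw [Matrix.adjugate_mul_distrib, Matrix.adjugate_mul_distrib]
        noncomm_ring
      rw [e, two_mul_adjugate_eq_trace, Matrix.mul_adjugate, ← add_smul, Matrix.mul_smul, mul_one,
        Matrix.smul_mul, Matrix.mul_adjugate, smul_smul] at hc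
      have h00 := congrFun (congrFun hc 0) 0
      simp only [Matrix.smul_apply, Matrix.one_apply_eq, smul_eq_mul, mul_one,
        Matrix.zero_apply] at h00
      exact eq_neg_of_add_eq_zero_left ((mul_eq_zero.1 h00).resolve_right hg)
    · have hC : C = h * -X.adjugate := by
        have h5 : g⁻¹ * (g * C.adjugate + g * X * h.adjugate) = 0 := by rw [hb, mul_zero]
        rw [mul_add, ← mul_assoc, mul_assoc g, ← mul_assoc, hgi'', one_mul, one_mul] at h5
        have h6 := congrArg Matrix.adjugate (eq_neg_of_add_eq_zero_left h5)
        rw [adjugate_neg_two, Matrix.adjugate_mul_distrib, adjugate_adjugate_two,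
          adjugate_adjugate_two] at h6
        rw [h6, mul_neg]
      rw [bdiag, Umat, blk_mul, hC]
      simp only [zero_mul, mul_zero, add_zero, zero_add, mul_one]

theorem mem_Sgrp_iff_Q3 {m : M6 F} : m ∈ Sgrp F ↔ m ∈ Q3 F ∧ bk m 0 0 = bk m 1 1 := by
  rw [mem_Sgrp_iff, mem_Q3_iff]
  constructor
  · rintro ⟨g, X, Z, hg, h, rfl⟩
    refine ⟨⟨g, g, X, Z, hg, hg, h, ?_⟩, ?_⟩
    · rw [div_self hg, one_smul, Dmat]
    · simp [Dmat, bdiag, Umat, blk_mul, bk_blk]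
  · rintro ⟨⟨g, h, X, Z, hg, hh, hXZ, rfl⟩, e⟩
    simp only [bdiag, Umat, blk_mul, bk_blk, mul_one, mul_zero, add_zero, zero_mul, zero_add] at e
    change g = h at e
    subst e
    refine ⟨g, X, Z, hg, hXZ, ?_⟩
    rw [div_self hg, one_smul, Dmat]

theorem bk_two_two_of_mem_Sgrp {m : M6 F} (hm : m ∈ Sgrp F) : bk m 2 2 = bk m 1 1 := by
  obtain ⟨g, X, Z, hg, h, rfl⟩ := mem_Sgrp_iff.1 hm
  simp [Dmat, bdiag, Umat, blk_mul, bk_blk]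

theorem one_mem_Q3 : (1 : M6 F) ∈ Q3 F := by
  refine mem_Q3_iff.2 ⟨1, 1, 0, 0, by simp, by simp, by simp, ?_⟩
  simp [bdiag, Umat, ← one_eq_blk]

theorem mul_mem_Q3 {m n : M6 F} (hm : m ∈ Q3 F) (hn : n ∈ Q3 F) : m * n ∈ Q3 F := by
  rw [mem_Q3_iff_sympAdj] at *
  obtain ⟨⟨h1, h2, h3⟩, h4, h5⟩ := hm
  obtain ⟨⟨k1, k2, k3⟩, k4, k5⟩ := hn
  have e : bk (m * n) 1 1 = bk m 1 1 * bk n 1 1 := by simp [bk_mul, h1, k3]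
  refine ⟨by simp [bk_mul, *], ?_, ?_⟩
  · rw [e, Matrix.det_mul]
    exact mul_ne_zero h4 k4
  · rw [e, Matrix.det_mul, sympAdj_mul, mul_assoc, ← mul_assoc n, k5, Matrix.smul_mul, one_mul,
      Matrix.mul_smul, h5, smul_smul, mul_comm]

theorem mem_Q3_of_mul_eq_one {m n : M6 F} (hm : m ∈ Q3 F) (hmn : m * n = 1) : n ∈ Q3 F ∧
    n = (bk m 1 1).det⁻¹ • sympAdj m := by
  rw [mem_Q3_iff_sympAdj] at *
  obtain ⟨⟨h1, h2, h3⟩, h4, h5⟩ := hm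
  have hn : n = (bk m 1 1).det⁻¹ • sympAdj m := by
    have h6 : m * ((bk m 1 1).det⁻¹ • sympAdj m) = 1 := by
      rw [Matrix.mul_smul, h5, smul_smul, inv_mul_cancel₀ h4, one_smul]
    have h7 : n * m = 1 := _root_.mul_eq_one_comm.1 hmn
    calc n = n * (m * ((bk m 1 1).det⁻¹ • sympAdj m)) := by rw [h6, mul_one]
      _ = _ := by rw [← mul_assoc, h7, one_mul]
  refine ⟨?_, hn⟩
  have h8 : sympAdj m * m = (bk m 1 1).det • (1 : M6 F) := by
    have h7 : n * m = 1 := _root_.mul_eq_one_comm.1 hmn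
    rw [hn, Matrix.smul_mul, inv_smul_eq_iff₀ h4] at h7
    exact h7
  have e : bk n 1 1 = (bk m 1 1).det⁻¹ • (bk m 1 1).adjugate := by
    rw [hn, bk_smul, bk_sympAdj]
    rfl
  have e' : (bk n 1 1).det = (bk m 1 1).det⁻¹ := by
    rw [e, Matrix.det_smul, Matrix.det_adjugate]
    simp
    field_simp
  rw [e']
  refine ⟨?_, inv_ne_zero h4, ?_⟩
  · rw [hn]
    simp only [bk_smul, bk_sympAdj]
    change _ • (bk m 2 1).adjugate = 0 ∧ _ • (bk m 2 0).adjugate = 0 ∧ _ • (bk m 1 0).adjugate = 0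
    rw [h1, h2, h3]
    simp
  · rw [hn, sympAdj_smul, sympAdj_sympAdj, Matrix.smul_mul, Matrix.mul_smul, h8, smul_smul,
      smul_smul, mul_assoc, inv_mul_cancel₀ h4, mul_one]

theorem one_mem_Sgrp : (1 : M6 F) ∈ Sgrp F :=
  mem_Sgrp_iff_Q3.2 ⟨one_mem_Q3, by simp [bk_one]⟩

theorem mul_mem_Sgrp {m n : M6 F} (hm : m ∈ Sgrp F) (hn : n ∈ Sgrp F) : m * n ∈ Sgrp F := by
  rw [mem_Sgrp_iff_Q3] at *
  refine ⟨mul_mem_Q3 hm.1 hn.1, ?_⟩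
  obtain ⟨⟨h1, h2, h3⟩, -⟩ := mem_Q3_iff_sympAdj.1 hm.1
  obtain ⟨⟨k1, k2, k3⟩, -⟩ := mem_Q3_iff_sympAdj.1 hn.1
  simp [bk_mul, hm.2, hn.2, h1, k1, k2, k3]

theorem mem_Sgrp_of_mul_eq_one {m n : M6 F} (hm : m ∈ Sgrp F) (hmn : m * n = 1) :
    n ∈ Sgrp F := by
  have hm' := mem_Sgrp_iff_Q3.1 hm
  obtain ⟨h1, h2⟩ := mem_Q3_of_mul_eq_one hm'.1 hmn
  refine mem_Sgrp_iff_Q3.2 ⟨h1, ?_⟩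
  rw [h2, bk_smul, bk_smul, bk_sympAdj, bk_sympAdj]
  change _ • (bk m 2 2).adjugate = _ • (bk m 1 1).adjugate
  rw [bk_two_two_of_mem_Sgrp hm]

theorem sgrp_subset_Q3 : Sgrp F ⊆ Q3 F := fun _ h => (mem_Sgrp_iff_Q3.1 h).1

theorem exists_mul_eq_one_of_mem_Q3 {m : M6 F} (hm : m ∈ Q3 F) : ∃ n, m * n = 1 := by
  obtain ⟨-, h4, h5⟩ := mem_Q3_iff_sympAdj.1 hm
  exact ⟨(bk m 1 1).det⁻¹ • sympAdj m, by
    rw [Matrix.mul_smul, h5, smul_smul, inv_mul_cancel₀ h4, one_smul]⟩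

theorem umat_mem_Sgrp {X Z : M2 F} (h : Z.trace = -X.det) : Umat X (-X.adjugate) Z ∈ Sgrp F := by
  refine mem_Sgrp_iff.2 ⟨1, X, Z, by simp, h, ?_⟩
  rw [Dmat, bdiag, ← one_eq_blk, one_mul]

theorem dmat_mem_Sgrp {g : M2 F} (h : g.det ≠ 0) : Dmat g ∈ Sgrp F := by
  refine mem_Sgrp_iff.2 ⟨g, 0, 0, h, by simp, ?_⟩
  simp [Umat, ← one_eq_blk]

theorem etaMat_mem_Q3 {h : M2 F} (hh : h.det ≠ 0) : etaMat h ∈ Q3 F := by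
  refine mem_Q3_iff.2 ⟨1, h, 0, 0, by simp, hh, by simp, ?_⟩
  simp [Umat, ← one_eq_blk, etaMat]

end Parabolic

section Groups

variable (F : Type*) [Field F]

/-- The parabolic subgroup as a subgroup of `GL 6`. -/
def Qg : Subgroup (GL (Fin 6) F) where
  carrier := {u | (u : M6 F) ∈ Q3 F}
  mul_mem' := fun {a b} ha hb => by
    simpa using mul_mem_Q3 ha hb
  one_mem' := by simpa using one_mem_Q3
  inv_mem' := fun {a} ha => (mem_Q3_of_mul_eq_one ha (by simp)).1

/-- The Shalika subgroup as a subgroup of `GL 6`. -/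
def Sg : Subgroup (GL (Fin 6) F) where
  carrier := {u | (u : M6 F) ∈ Sgrp F}
  mul_mem' := fun {a b} ha hb => by
    simpa using mul_mem_Sgrp ha hb
  one_mem' := by simpa using one_mem_Sgrp
  inv_mem' := fun {a} ha => mem_Sgrp_of_mul_eq_one ha (by simp)

variable {F}

theorem mem_Qg {u : GL (Fin 6) F} : u ∈ Qg F ↔ (u : M6 F) ∈ Q3 F := Iff.rfl

theorem exists_gl {a a' : M6 F} (h : a * a' = 1) :
    ∃ u : GL (Fin 6) F, (u : M6 F) = a ∧ ((u⁻¹ : GL (Fin 6) F) : M6 F) = a' :=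
  ⟨⟨a, a', h, _root_.mul_eq_one_comm.1 h⟩, rfl, rfl⟩

/-- The double coset of `σ` under the parabolic subgroup. -/
abbrev Cell (σ : M6 F) : Type _ := {m : M6 F // m ∈ setT (Q3 F) * {σ} * Q3 F}

theorem mem_cell_iff {σ m : M6 F} : m ∈ setT (Q3 F) * {σ} * Q3 F ↔
    ∃ a ∈ Q3 F, ∃ b ∈ Q3 F, m = aᵀ * σ * b := by
  constructor
  · rintro ⟨_, ⟨_, ⟨a, ha, rfl⟩, _, rfl, rfl⟩, b, hb, rfl⟩
    exact ⟨a, ha, b, hb, rfl⟩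
  · rintro ⟨a, ha, b, hb, rfl⟩
    exact Set.mul_mem_mul (Set.mul_mem_mul ⟨a, ha, rfl⟩ rfl) hb

theorem mul_mem_cell {σ m a b : M6 F} (ha : a ∈ Q3 F) (hb : b ∈ Q3 F)
    (hm : m ∈ setT (Q3 F) * {σ} * Q3 F) : aᵀ * m * b ∈ setT (Q3 F) * {σ} * Q3 F := by
  obtain ⟨c, hc, d, hd, rfl⟩ := mem_cell_iff.1 hm
  refine mem_cell_iff.2 ⟨c * a, mul_mem_Q3 hc ha, d * b, mul_mem_Q3 hd hb, ?_⟩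
  rw [Matrix.transpose_mul]
  simp only [mul_assoc]

instance cellAction (σ : M6 F) : MulAction (Qg F × Qg F) (Cell σ) where
  smul γ x := ⟨(((γ.1⁻¹ : Qg F) : GL (Fin 6) F) : M6 F)ᵀ * x.1 *
    (((γ.2⁻¹ : Qg F) : GL (Fin 6) F) : M6 F), mul_mem_cell (γ.1⁻¹).2 (γ.2⁻¹).2 x.2⟩
  one_smul x := Subtype.ext (by
    change (((1 : Qg F)⁻¹ : GL (Fin 6) F) : M6 F)ᵀ * x.1 * _ = x.1
    simp)
  mul_smul γ δ x := Subtype.ext (by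
    change ((((γ.1 * δ.1)⁻¹ : Qg F) : GL (Fin 6) F) : M6 F)ᵀ * x.1 *
      ((((γ.2 * δ.2)⁻¹ : Qg F) : GL (Fin 6) F) : M6 F) =
      (((γ.1⁻¹ : Qg F) : GL (Fin 6) F) : M6 F)ᵀ *
      ((((δ.1⁻¹ : Qg F) : GL (Fin 6) F) : M6 F)ᵀ * x.1 * (((δ.2⁻¹ : Qg F) : GL (Fin 6) F) : M6 F)) *
      (((γ.2⁻¹ : Qg F) : GL (Fin 6) F) : M6 F)
    rw [_root_.mul_inv_rev, _root_.mul_inv_rev, Subgroup.coe_mul, Subgroup.coe_mul, Units.val_mul,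
      Units.val_mul, Matrix.transpose_mul]
    simp only [mul_assoc])

theorem coe_smul_cell {σ : M6 F} (γ : Qg F × Qg F) (x : Cell σ) :
    ((γ • x : Cell σ) : M6 F) = (((γ.1⁻¹ : Qg F) : GL (Fin 6) F) : M6 F)ᵀ * x.1 *
      (((γ.2⁻¹ : Qg F) : GL (Fin 6) F) : M6 F) := rfl

theorem self_mem_cell (σ : M6 F) : σ ∈ setT (Q3 F) * {σ} * Q3 F :=
  mem_cell_iff.2 ⟨1, one_mem_Q3, 1, one_mem_Q3, by simp⟩

instance (σ : M6 F) : MulAction.IsPretransitive (Qg F × Qg F) (Cell σ) := by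
  have key : ∀ x : Cell σ, ∃ γ : Qg F × Qg F, γ • (⟨σ, self_mem_cell σ⟩ : Cell σ) = x := by
    rintro ⟨x, hx⟩
    obtain ⟨a, ha, b, hb, rfl⟩ := mem_cell_iff.1 hx
    obtain ⟨a', ha'⟩ := exists_mul_eq_one_of_mem_Q3 ha
    obtain ⟨b', hb'⟩ := exists_mul_eq_one_of_mem_Q3 hb
    obtain ⟨u, hu, -⟩ := exists_gl ha'
    obtain ⟨v, hv, -⟩ := exists_gl hb'
    refine ⟨(⟨u, mem_Qg.2 (hu ▸ ha)⟩⁻¹, ⟨v, mem_Qg.2 (hv ▸ hb)⟩⁻¹), Subtype.ext ?_⟩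
    rw [coe_smul_cell]
    simp only [inv_inv, hu, hv]
  constructor
  intro x y
  obtain ⟨γ, rfl⟩ := key x
  obtain ⟨δ, rfl⟩ := key y
  exact ⟨δ * γ⁻¹, by rw [mul_smul, inv_smul_smul]⟩

/-- Transposition on the double coset. -/
def transposeCell {σ : M6 F} (hσ : σᵀ ∈ setT (Q3 F) * {σ} * Q3 F) (x : Cell σ) : Cell σ :=
  ⟨x.1ᵀ, by
    obtain ⟨a, ha, b, hb, h⟩ := mem_cell_iff.1 x.2
    rw [h, Matrix.transpose_mul, Matrix.transpose_mul, Matrix.transpose_transpose, ← mul_assoc]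
    exact mul_mem_cell hb ha hσ⟩

theorem etaMat_mul (g h : M2 F) : etaMat g * etaMat h = etaMat (g * h) := by
  simp [etaMat, bdiag, blk_mul, Matrix.det_mul, smul_smul, mul_comm h.det]

theorem etaMat_one : etaMat (1 : M2 F) = 1 := by
  simp [etaMat, bdiag, one_eq_blk]

/-- Decomposition of an element of the parabolic subgroup along the Shalika subgroup. -/
theorem etaMat_mul_mem_Sgrp {q q' : M6 F} (hq : q ∈ Q3 F) (hqq : q * q' = 1) :
    (bk q 1 1 * bk q' 0 0) * (bk q 0 0 * bk q' 1 1) = 1 ∧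
      etaMat (bk q 0 0 * bk q' 1 1) * q ∈ Sgrp F := by
  obtain ⟨hq', -⟩ := mem_Q3_of_mul_eq_one hq hqq
  obtain ⟨⟨h1, h2, h3⟩, -⟩ := mem_Q3_iff_sympAdj.1 hq
  obtain ⟨⟨k1, k2, k3⟩, -⟩ := mem_Q3_iff_sympAdj.1 hq'
  have h00 : bk q 0 0 * bk q' 0 0 = 1 := by
    have := congrArg (fun m => bk m 0 0) hqq
    simpa [bk_mul, k1, k2, bk_one] using this
  have h11 : bk q 1 1 * bk q' 1 1 = 1 := by
    have := congrArg (fun m => bk m 1 1) hqq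
    simpa [bk_mul, h1, k3, bk_one] using this
  have h00' := _root_.mul_eq_one_comm.1 h00
  have h11' := _root_.mul_eq_one_comm.1 h11
  have e : (bk q 1 1 * bk q' 0 0) * (bk q 0 0 * bk q' 1 1) = 1 := by
    rw [mul_assoc, ← mul_assoc (bk q' 0 0), h00', one_mul, h11]
  refine ⟨e, mem_Sgrp_iff_Q3.2 ⟨mul_mem_Q3 (etaMat_mem_Q3 ?_) hq, ?_⟩⟩
  · intro h0
    have := congrArg Matrix.det e
    rw [Matrix.det_mul, h0, mul_zero, Matrix.det_one] at this
    exact zero_ne_one this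
  · simp [bk_mul, etaMat, bdiag, bk_blk, h1, h2, h3, mul_assoc, h11']

end Groups

section Topological

variable {F : Type*} [Field F] [TopologicalSpace F]

theorem continuous_bk (i j : Fin 3) : Continuous fun m : M6 F => bk m i j :=
  continuous_matrix fun _ _ => continuous_id.matrix_elem _ _

theorem continuous_blk {Y : Type*} [TopologicalSpace Y] {f : Y → Fin 3 → Fin 3 → M2 F}
    (hf : ∀ i j, Continuous fun y => f y i j) : Continuous fun y => blk (f y) :=
  continuous_matrix fun _ _ => (hf _ _).matrix_elem _ _

theorem continuous_transposeCell {σ : M6 F} (hσ : σᵀ ∈ setT (Q3 F) * {σ} * Q3 F) :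
    Continuous (transposeCell hσ) :=
  Continuous.subtype_mk continuous_subtype_val.matrix_transpose _

variable [IsTopologicalRing F]

theorem continuous_etaMat : Continuous (etaMat : M2 F → M6 F) := by
  refine continuous_blk fun i j => ?_
  fin_cases i <;> fin_cases j
  all_goals first
    | exact continuous_const
    | exact continuous_id
    | exact (continuous_id.matrix_det).smul continuous_const

theorem continuous_sympAdj : Continuous (sympAdj : M6 F → M6 F) :=
  continuous_blk fun _ _ => (continuous_bk _ _).matrix_adjugate

theorem isClosed_Qg [T1Space F] : IsClosed (Qg F : Set (GL (Fin 6) F)) := by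
  have e : (Qg F : Set (GL (Fin 6) F)) = {u : GL (Fin 6) F |
      (bk (u : M6 F) 1 0 = 0 ∧ bk (u : M6 F) 2 0 = 0 ∧ bk (u : M6 F) 2 1 = 0) ∧
        (u : M6 F) * sympAdj u = (bk (u : M6 F) 1 1).det • (1 : M6 F)} := by
    ext u
    rw [SetLike.mem_coe, mem_Qg, mem_Q3_iff_sympAdj]
    refine ⟨fun h => ⟨h.1, h.2.2⟩, fun h => ⟨h.1, fun h0 => ?_, h.2⟩⟩
    have h1 := h.2
    rw [h0, zero_smul] at h1
    have h2 : sympAdj (u : M6 F) = 0 := (Units.mul_right_eq_zero u).1 h1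
    have h3 : (u : M6 F) = 0 := by
      rw [← sympAdj_sympAdj (u : M6 F), h2]
      apply bk_ext
      intro i j
      rw [bk_sympAdj]
      exact Matrix.adjugate_zero
    exact u.ne_zero h3
  rw [e]
  have hc : ∀ i j, Continuous fun u : GL (Fin 6) F => bk (u : M6 F) i j := fun i j =>
    (continuous_bk i j).comp Units.continuous_val
  refine IsClosed.inter (IsClosed.inter ?_ (IsClosed.inter ?_ ?_)) ?_
  · exact isClosed_eq (hc _ _) continuous_const
  · exact isClosed_eq (hc _ _) continuous_const
  · exact isClosed_eq (hc _ _) continuous_const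
  · exact isClosed_eq (Units.continuous_val.mul (continuous_sympAdj.comp Units.continuous_val))
      ((hc _ _).matrix_det.smul continuous_const)

theorem isClosed_Sg [T1Space F] : IsClosed (Sg F : Set (GL (Fin 6) F)) := by
  have e : (Sg F : Set (GL (Fin 6) F)) = (Qg F : Set (GL (Fin 6) F)) ∩
      {u | bk (u : M6 F) 0 0 = bk (u : M6 F) 1 1} := by
    ext u
    exact mem_Sgrp_iff_Q3
  rw [e]
  exact isClosed_Qg.inter (isClosed_eq ((continuous_bk _ _).comp Units.continuous_val)
    ((continuous_bk _ _).comp Units.continuous_val))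

instance continuousSMul_cell (σ : M6 F) : ContinuousSMul (Qg F × Qg F) (Cell σ) := by
  constructor
  refine Continuous.subtype_mk ?_ _
  have h1 : Continuous fun p : (Qg F × Qg F) × Cell σ =>
      (((p.1.1⁻¹ : Qg F) : GL (Fin 6) F) : M6 F) :=
    Units.continuous_val.comp (continuous_subtype_val.comp continuous_fst.fst.inv)
  have h2 : Continuous fun p : (Qg F × Qg F) × Cell σ =>
      (((p.1.2⁻¹ : Qg F) : GL (Fin 6) F) : M6 F) :=
    Units.continuous_val.comp (continuous_subtype_val.comp continuous_fst.snd.inv)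
  exact (h1.matrix_transpose.mul (continuous_subtype_val.comp continuous_snd)).mul h2

end Topological

section Bounds

theorem norm_sub_le_max' {F : Type*} [NontriviallyNormedField F] [IsUltrametricDist F] (x y : F) :
    ‖x - y‖ ≤ max ‖x‖ ‖y‖ := by
  rw [sub_eq_add_neg, ← norm_neg y]
  exact IsUltrametricDist.norm_add_le_max _ _

variable {F : Type*} [NontriviallyNormedField F]

/-- Weighted bound on the entries of a 6×6 matrix. -/
def WBound (C : ℝ) (m : M6 F) : Prop :=
  ∀ i j : Fin 6, ‖m i j‖ * C ^ (i.val / 2) ≤ C ^ (j.val / 2)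

theorem wBound_one {C : ℝ} (hC : 1 ≤ C) : WBound C (1 : M6 F) := by
  intro i j
  by_cases h : i = j
  · subst h
    simp
  · rw [Matrix.one_apply_ne h]
    simp only [norm_zero, zero_mul]
    positivity

/-- All entries of a 2×2 matrix have norm at most `c`. -/
def EntryLe (c : ℝ) (m : M2 F) : Prop := ∀ i j, ‖m i j‖ ≤ c

theorem entryLe_fin_two {c : ℝ} {x y z w : F} (h1 : ‖x‖ ≤ c) (h2 : ‖y‖ ≤ c) (h3 : ‖z‖ ≤ c)
    (h4 : ‖w‖ ≤ c) : EntryLe c !![x, y; z, w] := by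
  intro i j
  fin_cases i <;> fin_cases j
  exacts [h1, h2, h3, h4]

theorem EntryLe.neg {c : ℝ} {m : M2 F} (h : EntryLe c m) : EntryLe c (-m) := fun i j => by
  simpa using h i j

theorem EntryLe.adjugate {c : ℝ} {m : M2 F} (h : EntryLe c m) : EntryLe c m.adjugate := by
  rw [Matrix.adjugate_fin_two]
  exact entryLe_fin_two (h 1 1) (by simpa using h 0 1) (by simpa using h 1 0) (h 0 0)

theorem wBound_blk {C : ℝ} (hC : 1 ≤ C) {a b c d e f : M2 F} (ha : EntryLe 1 a)
    (hb : EntryLe C b) (hc : EntryLe (C ^ 2) c) (hd : EntryLe 1 d) (he : EntryLe C e)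
    (hf : EntryLe 1 f) : WBound C (blk ![![a, b, c], ![0, d, e], ![0, 0, f]]) := by
  have h0 : 0 ≤ C := by linarith
  have key : ∀ (i j : Fin 3) (x y : Fin 2),
      ‖(![![a, b, c], ![0, d, e], ![0, 0, f]] i j : M2 F) x y‖ * C ^ i.val ≤ C ^ j.val := by
    intro i j x y
    have hz : ∀ n m : ℕ, ‖(0 : M2 F) x y‖ * C ^ n ≤ C ^ m := fun n m => by
      rw [Matrix.zero_apply, norm_zero, zero_mul]
      positivity
    have h1 : ∀ (g : M2 F) (n m l : ℕ), EntryLe (C ^ l) g → l + n = m →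
        ‖g x y‖ * C ^ n ≤ C ^ m := fun g n m l hg hl => by
      rw [← hl, pow_add]
      exact mul_le_mul_of_nonneg_right (hg x y) (by positivity)
    fin_cases i <;> fin_cases j
    · exact h1 a 0 0 0 (by simpa using ha) rfl
    · exact h1 b 0 1 1 (by simpa using hb) rfl
    · exact h1 c 0 2 2 hc rfl
    · exact hz 1 0
    · exact h1 d 1 1 0 (by simpa using hd) rfl
    · exact h1 e 1 2 1 (by simpa using he) rfl
    · exact hz 2 0
    · exact hz 2 1
    · exact h1 f 2 2 0 (by simpa using hf) rfl
  exact fun i j => key ⟨i.val / 2, by omega⟩ ⟨j.val / 2, by omega⟩ ⟨i.val % 2, by omega⟩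
    ⟨j.val % 2, by omega⟩

theorem entryLe_one {c : ℝ} (hc : 1 ≤ c) : EntryLe c (1 : M2 F) := by
  intro i j
  by_cases h : i = j
  · subst h
    simpa using hc
  · rw [Matrix.one_apply_ne h, norm_zero]
    linarith

theorem entryLe_zero {c : ℝ} (hc : 0 ≤ c) : EntryLe c (0 : M2 F) := fun i j => by
  rw [Matrix.zero_apply, norm_zero]
  exact hc

theorem wBound_umat {C : ℝ} (hC : 1 ≤ C) {X Y Z : M2 F} (hX : EntryLe C X) (hY : EntryLe C Y)
    (hZ : EntryLe (C ^ 2) Z) : WBound C (Umat X Y Z) :=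
  wBound_blk hC (entryLe_one le_rfl) hX hZ (entryLe_one le_rfl) hY (entryLe_one le_rfl)

theorem wBound_dmat {C : ℝ} (hC : 1 ≤ C) {g : M2 F} (hg : EntryLe 1 g) : WBound C (Dmat g) :=
  wBound_blk hC hg (entryLe_zero (by linarith)) (entryLe_zero (by positivity)) hg
    (entryLe_zero (by linarith)) hg

/-- Elements of the Shalika group which are bounded together with their inverse. -/
def SBound (C : ℝ) (a : M6 F) : Prop :=
  a ∈ Sgrp F ∧ ∃ a', a * a' = 1 ∧ WBound C a ∧ WBound C a'

theorem sBound_dmat {C : ℝ} (hC : 1 ≤ C) {g : M2 F} (hg : EntryLe 1 g) (hd : ‖g.det‖ = 1) :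
    SBound C (Dmat g) := by
  have hd0 : g.det ≠ 0 := by
    intro h0
    rw [h0, norm_zero] at hd
    exact zero_ne_one hd
  refine ⟨dmat_mem_Sgrp hd0, Dmat (g.det⁻¹ • g.adjugate), ?_, wBound_dmat hC hg,
    wBound_dmat hC fun i j => ?_⟩
  · simp [Dmat, bdiag, blk_mul, one_eq_blk, Matrix.mul_adjugate, smul_smul, inv_mul_cancel₀ hd0]
  · rw [Matrix.smul_apply, norm_smul, norm_inv, hd, inv_one, one_mul]
    exact hg.adjugate i j

theorem sBound_one {C : ℝ} (hC : 1 ≤ C) : SBound C (1 : M6 F) :=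
  ⟨one_mem_Sgrp, 1, one_mul 1, wBound_one hC, wBound_one hC⟩

variable [IsUltrametricDist F]

theorem WBound.mul {C : ℝ} (hC : 1 ≤ C) {m n : M6 F} (hm : WBound C m) (hn : WBound C n) :
    WBound C (m * n) := by
  intro i j
  rw [Matrix.mul_apply, ← le_div_iff₀ (by positivity)]
  refine IsUltrametricDist.norm_sum_le_of_forall_le_of_nonneg (by positivity) fun l _ => ?_
  rw [le_div_iff₀ (by positivity), norm_mul]
  calc ‖m i l‖ * ‖n l j‖ * C ^ (i.val / 2) = (‖m i l‖ * C ^ (i.val / 2)) * ‖n l j‖ := by ring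
    _ ≤ C ^ (l.val / 2) * ‖n l j‖ := by gcongr; exact hm i l
    _ = ‖n l j‖ * C ^ (l.val / 2) := mul_comm _ _
    _ ≤ _ := hn l j

theorem EntryLe.sub {c : ℝ} {m n : M2 F} (hm : EntryLe c m) (hn : EntryLe c n) :
    EntryLe c (m - n) := fun i j =>
  (norm_sub_le_max' _ _).trans (max_le (hm i j) (hn i j))

theorem EntryLe.norm_det {c : ℝ} {m : M2 F} (h : EntryLe c m) : ‖m.det‖ ≤ c ^ 2 := by
  have h0 : 0 ≤ c := (norm_nonneg _).trans (h 0 0)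
  rw [Matrix.det_fin_two]
  refine (norm_sub_le_max' _ _).trans (max_le ?_ ?_)
  · rw [norm_mul, sq]
    exact mul_le_mul (h 0 0) (h 1 1) (norm_nonneg _) h0
  · rw [norm_mul, sq]
    exact mul_le_mul (h 0 1) (h 1 0) (norm_nonneg _) h0

theorem sBound_umat {C : ℝ} (hC : 1 ≤ C) {X Z : M2 F} (h : Z.trace = -X.det) (hX : EntryLe C X)
    (hZ : EntryLe (C ^ 2) Z) : SBound C (Umat X (-X.adjugate) Z) := by
  refine ⟨umat_mem_Sgrp h, Umat (-X) X.adjugate (-(X.det • (1 : M2 F)) - Z), ?_,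
    wBound_umat hC hX hX.adjugate.neg hZ, wBound_umat hC hX.neg hX.adjugate ?_⟩
  · rw [Umat, Umat, blk_mul, one_eq_blk, blk_inj]
    simp [Matrix.mul_adjugate]
    abel
  · refine EntryLe.sub (EntryLe.neg ?_) hZ
    intro i j
    by_cases h : i = j
    · subst h
      simpa using hX.norm_det
    · simp only [Matrix.smul_apply, Matrix.one_apply_ne h, smul_zero, norm_zero]
      positivity

theorem SBound.mul {C : ℝ} (hC : 1 ≤ C) {a b : M6 F} (ha : SBound C a) (hb : SBound C b) :
    SBound C (a * b) := by
  obtain ⟨h1, a', h2, h3, h4⟩ := ha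
  obtain ⟨k1, b', k2, k3, k4⟩ := hb
  refine ⟨mul_mem_Sgrp h1 k1, b' * a', ?_, h3.mul hC k3, k4.mul hC h4⟩
  rw [mul_assoc, ← mul_assoc b, k2, one_mul, h2]

/-- The bounded elements of the Shalika group, as a subgroup. -/
def boundedSg (F : Type*) [NontriviallyNormedField F] [IsUltrametricDist F] (C : ℝ) (hC : 1 ≤ C) :
    Subgroup (GL (Fin 6) F) where
  carrier := {u | (u : M6 F) ∈ Sgrp F ∧ WBound C (u : M6 F) ∧
    WBound C ((u⁻¹ : GL (Fin 6) F) : M6 F)}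
  mul_mem' := fun {a b} ha hb => by
    refine ⟨mul_mem_Sgrp ha.1 hb.1, ha.2.1.mul hC hb.2.1, ?_⟩
    rw [_root_.mul_inv_rev]
    exact hb.2.2.mul hC ha.2.2
  one_mem' := by
    refine ⟨one_mem_Sgrp, wBound_one hC, ?_⟩
    rw [inv_one]
    exact wBound_one hC
  inv_mem' := fun {a} ha => ⟨mem_Sgrp_of_mul_eq_one ha.1 (by simp), ha.2.2, by
    rw [inv_inv]
    exact ha.2.1⟩

theorem exists_boundedSg {C : ℝ} (hC : 1 ≤ C) {a : M6 F} (ha : SBound C a) :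
    ∃ u ∈ boundedSg F C hC, (u : M6 F) = a := by
  obtain ⟨h1, a', h2, h3, h4⟩ := ha
  obtain ⟨u, rfl, rfl⟩ := exists_gl h2
  exact ⟨u, ⟨h1, h3, h4⟩, rfl⟩

theorem isCompact_boundedSg [ProperSpace F] {C : ℝ} (hC : 1 ≤ C) :
    IsCompact (boundedSg F C hC : Set (GL (Fin 6) F)) := by
  let B : Set (M6 F) := {m | WBound C m}
  have hB : IsCompact B := by
    have e : B = Set.univ.pi fun i => Set.univ.pi fun j =>
        Metric.closedBall (0 : F) (C ^ (j.val / 2) / C ^ (i.val / 2)) := by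
      have h : ∀ (m : M6 F) (i j : Fin 6),
          m i j ∈ Metric.closedBall (0 : F) (C ^ (j.val / 2) / C ^ (i.val / 2)) ↔
          ‖m i j‖ * C ^ (i.val / 2) ≤ C ^ (j.val / 2) := fun m i j => by
        rw [mem_closedBall_zero_iff, le_div_iff₀ (by positivity)]
      ext m
      exact ⟨fun hm i _ j _ => (h m i j).2 (hm i j),
        fun hm i j => (h m i j).1 (hm i trivial j trivial)⟩
    rw [e]
    exact isCompact_univ_pi fun i => isCompact_univ_pi fun j => isCompact_closedBall _ _
  have hc := Units.isClosedEmbedding_embedProduct (α := M6 F) |>.isCompact_preimage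
    (hB.prod (hB.image MulOpposite.continuous_op))
  refine hc.of_isClosed_subset ?_ ?_
  · have hBc : IsClosed B := hB.isClosed
    exact isClosed_Sg.inter ((hBc.preimage Units.continuous_val).inter
      (hBc.preimage (Units.continuous_val.comp continuous_inv)))
  · intro u hu
    exact ⟨hu.2.1, _, hu.2.2, rfl⟩

instance sigmaCompactSpace_Qg [ProperSpace F] : SigmaCompactSpace (Qg F) := by
  have : SecondCountableTopology F := secondCountable_of_proper
  have : SigmaCompactSpace (M6 F) := inferInstanceAs (SigmaCompactSpace (Fin 6 → Fin 6 → F))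
  have : SigmaCompactSpace (M6 F)ᵐᵒᵖ :=
    MulOpposite.opHomeomorph.symm.isClosedEmbedding.sigmaCompactSpace
  have : SigmaCompactSpace (GL (Fin 6) F) :=
    (Units.isClosedEmbedding_embedProduct (α := M6 F)).sigmaCompactSpace
  exact isClosed_Qg.sigmaCompactSpace

theorem sBound_of_near_one {a a' : M6 F} (ha : a ∈ Sgrp F) (h : a * a' = 1)
    (h1 : ∀ i j, ‖a i j - (1 : M6 F) i j‖ < 1) (h2 : ∀ i j, ‖a' i j - (1 : M6 F) i j‖ < 1) :
    SBound 1 a := by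
  have key : ∀ m : M6 F, (∀ i j, ‖m i j - (1 : M6 F) i j‖ < 1) → WBound 1 m := by
    intro m hm i j
    rw [one_pow, one_pow, mul_one]
    have e : m i j = (m i j - (1 : M6 F) i j) + (1 : M6 F) i j := by ring
    rw [e]
    refine (IsUltrametricDist.norm_add_le_max _ _).trans (max_le (hm i j).le ?_)
    by_cases hij : i = j
    · subst hij; simp
    · simp [Matrix.one_apply_ne hij]
  exact ⟨ha, a', h, key _ h1, key _ h2⟩

theorem eventually_near_one {Y : Type*} [TopologicalSpace Y] {f : Y → M6 F} {y₀ : Y}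
    (hf : ContinuousAt f y₀) (h : f y₀ = 1) :
    ∀ᶠ y in 𝓝 y₀, ∀ i j, ‖f y i j - (1 : M6 F) i j‖ < 1 := by
  rw [Filter.eventually_all]
  intro i
  rw [Filter.eventually_all]
  intro j
  have hc : ContinuousAt (fun y => ‖f y i j - (1 : M6 F) i j‖) y₀ :=
    ((((continuous_id.matrix_elem i j).continuousAt.comp hf)).sub continuousAt_const).norm
  exact hc.eventually_lt_const (by simp [h])

end Bounds

section Character

variable {F : Type*} [Field F]

theorem shalikaCharacter_eq {ψk : F → ℂˣ} {ψS : M6 F → ℂˣ} (hψS : IsShalikaCharacter ψk ψS)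
    {s s' : M6 F} (hs : s ∈ Sgrp F) (h : s * s' = 1) :
    ψS s = ψk (-(bk s' 0 0 * bk s 0 1).trace) := by
  have h' := congrArg (fun m => bk m 0 0) (_root_.mul_eq_one_comm.1 h)
  obtain ⟨g, X, Z, hg, hZ, rfl⟩ := mem_Sgrp_iff.1 hs
  simp only [bk_mul, bk_one, Dmat, bdiag, Umat, bk_blk] at h'
  simp only [Fin.isValue, cons_val_zero, mul_one, cons_val_one, mul_zero, add_zero, cons_val,
    reduceIte] at h'
  rw [hψS.1 _ (dmat_mem_Sgrp hg) _ (umat_mem_Sgrp hZ), hψS.2.2 g (isUnit_iff_det_ne_zero.2 hg),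
    hψS.2.1 _ _ _ (mul_Jmat_add_eq_zero_iff.2 rfl) (mul_Jmat_add_eq_neg_iff.2 hZ), one_mul]
  have e : bk s' 0 0 * bk (Dmat g * Umat X (-X.adjugate) Z) 0 1 = X := by
    rw [bk_mul]
    simp [Dmat, bdiag, Umat, bk_blk, ← mul_assoc, h']
  rw [e]

theorem shalikaCharacter_one {ψk : F → ℂˣ} {ψS : M6 F → ℂˣ} (hψS : IsShalikaCharacter ψk ψS) :
    ψS 1 = 1 := by
  have h := hψS.2.2 1 isUnit_one
  have e : Dmat (1 : M2 F) = 1 := by rw [Dmat, bdiag, one_eq_blk]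
  rwa [e] at h

theorem shalikaCharacter_umat {ψk : F → ℂˣ} {ψS : M6 F → ℂˣ} (hψS : IsShalikaCharacter ψk ψS)
    {X Z : M2 F} (hZ : Z.trace = -X.det) : ψS (Umat X (-X.adjugate) Z) = ψk (-X.trace) :=
  hψS.2.1 _ _ _ (mul_Jmat_add_eq_zero_iff.2 rfl) (mul_Jmat_add_eq_neg_iff.2 hZ)

theorem addChar_zero {ψk : F → ℂˣ} (hψk : ∀ x y : F, ψk (x + y) = ψk x * ψk y) : ψk 0 = 1 := by
  have := hψk 0 0
  rw [add_zero] at this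
  exact (mul_eq_left.1 this.symm)

end Character

section Equivariance

variable {F : Type*} [NontriviallyNormedField F]

/-- An odd functional on the test functions of a double coset which is equivariant under the
Shalika group on both sides. -/
structure OddShalika (ψS : M6 F → ℂˣ) {σ : M6 F} (hσ : σᵀ ∈ setT (Q3 F) * {σ} * Q3 F)
    (T : testFun (Cell σ) →ₗ[ℂ] ℂ) : Prop where
  smul : ∀ a b : Qg F, (a : GL (Fin 6) F) ∈ Sg F → (b : GL (Fin 6) F) ∈ Sg F →
    ∀ f f' : testFun (Cell σ), (∀ x, f'.1 x = f.1 ((a, b) • x)) →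
      T f' = ψS ((a : GL (Fin 6) F) : M6 F) * ψS ((b : GL (Fin 6) F) : M6 F) * T f
  odd : ∀ f f' : testFun (Cell σ), (∀ x, f'.1 x = f.1 (transposeCell hσ x)) → T f' = -T f

/-- Transposition as a homeomorphism of a double coset. -/
def transposeHomeo {σ : M6 F} (hσ : σᵀ ∈ setT (Q3 F) * {σ} * Q3 F) : Cell σ ≃ₜ Cell σ where
  toFun := transposeCell hσ
  invFun := transposeCell hσ
  left_inv x := Subtype.ext (Matrix.transpose_transpose x.1)
  right_inv x := Subtype.ext (Matrix.transpose_transpose x.1)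
  continuous_toFun := continuous_transposeCell hσ
  continuous_invFun := continuous_transposeCell hσ

theorem eventually_shalikaCharacter_eq_one {ψk : F → ℂˣ} {ψS : M6 F → ℂˣ}
    (hψk : ∀ x y : F, ψk (x + y) = ψk x * ψk y) (hlc : IsLocallyConstant ψk)
    (hψS : IsShalikaCharacter ψk ψS) :
    ∀ᶠ u : GL (Fin 6) F in 𝓝 1, u ∈ Sg F → ψS (u : M6 F) = 1 := by
  have hc : Continuous fun u : GL (Fin 6) F =>
      -(bk ((u⁻¹ : GL (Fin 6) F) : M6 F) 0 0 * bk (u : M6 F) 0 1).trace :=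
    ((((continuous_bk 0 0).comp (Units.continuous_val.comp continuous_inv)).matrix_mul
      ((continuous_bk 0 1).comp Units.continuous_val)).matrix_trace).neg
  have h1 : ∀ᶠ u : GL (Fin 6) F in 𝓝 1,
      ψk (-(bk ((u⁻¹ : GL (Fin 6) F) : M6 F) 0 0 * bk (u : M6 F) 0 1).trace) = 1 := by
    refine ((hlc.isOpen_fiber 1).preimage hc).mem_nhds ?_
    have e : -(bk (((1 : GL (Fin 6) F)⁻¹ : GL (Fin 6) F) : M6 F) 0 0 *
        bk ((1 : GL (Fin 6) F) : M6 F) 0 1).trace = 0 := by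
      simp [bk_one]
    exact (congrArg ψk e).trans (addChar_zero hψk)
  filter_upwards [h1] with u hu hs
  rw [shalikaCharacter_eq hψS hs u.mul_inv, hu]

variable [IsUltrametricDist F]

/-- Pairs of bounded elements of the Shalika group. -/
def boundedPair (F : Type*) [NontriviallyNormedField F] [IsUltrametricDist F] (C : ℝ)
    (hC : 1 ≤ C) : Subgroup (Qg F × Qg F) :=
  ((boundedSg F C hC).subgroupOf (Qg F)).prod ((boundedSg F C hC).subgroupOf (Qg F))

instance compactSpace_boundedPair [ProperSpace F] {C : ℝ} (hC : 1 ≤ C) :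
    CompactSpace (boundedPair F C hC) := by
  have h : IsCompact (((boundedSg F C hC).subgroupOf (Qg F) : Subgroup (Qg F)) : Set (Qg F)) :=
    (isClosed_Qg (F := F)).isClosedEmbedding_subtypeVal.isCompact_preimage (isCompact_boundedSg hC)
  have h2 : IsCompact ((boundedPair F C hC : Subgroup (Qg F × Qg F)) : Set (Qg F × Qg F)) := by
    rw [boundedPair, Subgroup.coe_prod]
    exact h.prod h
  exact isCompact_iff_compactSpace.1 h2

/-- The character of pairs of Shalika elements. -/
def pairCharacter {ψk : F → ℂˣ} {ψS : M6 F → ℂˣ} (hψS : IsShalikaCharacter ψk ψS) {C : ℝ}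
    (hC : 1 ≤ C) : boundedPair F C hC →* ℂˣ :=
  MonoidHom.mk' (fun γ => ψS ((γ.1.1 : GL (Fin 6) F) : M6 F) * ψS ((γ.1.2 : GL (Fin 6) F) : M6 F))
    fun γ δ => by
      change ψS (((γ.1.1 : GL (Fin 6) F) : M6 F) * ((δ.1.1 : GL (Fin 6) F) : M6 F)) *
        ψS (((γ.1.2 : GL (Fin 6) F) : M6 F) * ((δ.1.2 : GL (Fin 6) F) : M6 F)) = _
      exact (congrArg₂ _ (hψS.1 _ γ.2.1.1 _ δ.2.1.1) (hψS.1 _ γ.2.2.1 _ δ.2.2.1)).trans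
        (mul_mul_mul_comm _ _ _ _)

theorem isOpen_ker_pairCharacter {ψk : F → ℂˣ} {ψS : M6 F → ℂˣ}
    (hψk : ∀ x y : F, ψk (x + y) = ψk x * ψk y) (hlc : IsLocallyConstant ψk)
    (hψS : IsShalikaCharacter ψk ψS) {C : ℝ} (hC : 1 ≤ C) :
    IsOpen ((pairCharacter hψS hC).ker : Set (boundedPair F C hC)) := by
  refine Subgroup.isOpen_of_mem_nhds _ (g := 1) ?_
  have h := eventually_shalikaCharacter_eq_one hψk hlc hψS
  have c1 : Continuous fun γ : boundedPair F C hC => (γ.1.1 : GL (Fin 6) F) := by fun_prop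
  have c2 : Continuous fun γ : boundedPair F C hC => (γ.1.2 : GL (Fin 6) F) := by fun_prop
  filter_upwards [(c1.tendsto 1).eventually h, (c2.tendsto 1).eventually h]
    with γ h1 h2
  change ψS _ * ψS _ = 1
  rw [h1 γ.2.1.1, h2 γ.2.2.1, one_mul]

/-- Vanishing criterion for odd equivariant functionals on a double coset. -/
theorem OddShalika.vanishesNear [ProperSpace F] {ψk : F → ℂˣ} {ψS : M6 F → ℂˣ}
    (hψk : ∀ x y : F, ψk (x + y) = ψk x * ψk y) (hlc : IsLocallyConstant ψk)
    (hψS : IsShalikaCharacter ψk ψS) {σ : M6 F} {hσ : σᵀ ∈ setT (Q3 F) * {σ} * Q3 F}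
    {T : testFun (Cell σ) →ₗ[ℂ] ℂ} (hT : OddShalika ψS hσ T) [LocallyCompactSpace (Cell σ)]
    {C : ℝ} (hC : 1 ≤ C) {x₀ : Cell σ}
    (h : ∀ᶠ x in 𝓝 x₀, VanishesNear T x ∨ ∀ f : Cell σ → ℂ,
      (∀ a b : M6 F, SBound C a → SBound C b → ∀ y z : Cell σ, z.1 = aᵀ * y.1 * b →
        f y = ψS a * ψS b * f z) → (∀ y z : Cell σ, z.1 = y.1ᵀ → f z = -f y) → f x = 0) :
    VanishesNear T x₀ := by
  have : TotallyDisconnectedSpace (M6 F) :=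
    inferInstanceAs (TotallyDisconnectedSpace (Fin 6 → Fin 6 → F))
  refine vanishesNear_of_equivariant (K := boundedPair F C hC) (pairCharacter hψS hC)
    (isOpen_ker_pairCharacter hψk hlc hψS hC) (transposeHomeo hσ)
    (fun x => Subtype.ext (Matrix.transpose_transpose x.1))
    (fun γ => ⟨(γ.1.2, γ.1.1), γ.2.2, γ.2.1⟩) ?_ (fun γ => mul_comm _ _) T ?_ hT.odd x₀ ?_
  · intro γ x
    refine Subtype.ext ?_
    change ((((γ.1.1⁻¹ : Qg F) : GL (Fin 6) F) : M6 F)ᵀ * x.1 *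
      (((γ.1.2⁻¹ : Qg F) : GL (Fin 6) F) : M6 F))ᵀ = (((γ.1.2⁻¹ : Qg F) : GL (Fin 6) F) : M6 F)ᵀ *
      x.1ᵀ * (((γ.1.1⁻¹ : Qg F) : GL (Fin 6) F) : M6 F)
    simp only [Matrix.transpose_mul, Matrix.transpose_transpose, mul_assoc]
  · intro γ f f' hf
    have := hT.smul γ.1.1 γ.1.2 γ.2.1.1 γ.2.2.1 f f' hf
    rw [this]
    simp [pairCharacter]
  · filter_upwards [h] with x hx
    refine hx.imp id fun hx f hf1 hf2 => hx f ?_ ?_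
    · intro a b ha hb y z hz
      obtain ⟨u, hu, rfl⟩ := exists_boundedSg hC ha
      obtain ⟨v, hv, rfl⟩ := exists_boundedSg hC hb
      let γ : boundedPair F C hC :=
        ⟨(⟨u, sgrp_subset_Q3 hu.1⟩, ⟨v, sgrp_subset_Q3 hv.1⟩), hu, hv⟩
      have e : y = γ • z := by
        have : z = γ⁻¹ • y := Subtype.ext (by
          rw [hz]
          change _ = ((((γ.1.1⁻¹⁻¹ : Qg F)) : GL (Fin 6) F) : M6 F)ᵀ * y.1 *
            ((((γ.1.2⁻¹⁻¹ : Qg F)) : GL (Fin 6) F) : M6 F)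
          rw [inv_inv, inv_inv])
        rw [this, smul_inv_smul]
      rw [e, hf1]
      simp [pairCharacter, γ]
    · intro y z hz
      have : z = transposeHomeo hσ y := Subtype.ext hz
      rw [this, hf2]

end Equivariance

section CellPoints

/-- The element `η(h₁)ᵀ σ η(h₂)`. -/
def cellPt {F : Type*} [Field F] (σ : M6 F) (h₁ h₂ : M2 F) : M6 F :=
  (etaMat h₁)ᵀ * σ * etaMat h₂

theorem cellPt_mem {F : Type*} [Field F] (σ : M6 F) {h₁ h₂ : M2 F} (d₁ : h₁.det ≠ 0)
    (d₂ : h₂.det ≠ 0) : cellPt σ h₁ h₂ ∈ setT (Q3 F) * {σ} * Q3 F :=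
  mem_cell_iff.2 ⟨_, etaMat_mem_Q3 d₁, _, etaMat_mem_Q3 d₂, rfl⟩

theorem exists_eq_etaMat_mul {F : Type*} [Field F] {q : M6 F} (hq : q ∈ Q3 F) :
    ∃ r s, r.det ≠ 0 ∧ s ∈ Sgrp F ∧ q = etaMat r * s := by
  obtain ⟨q', hqq⟩ := exists_mul_eq_one_of_mem_Q3 hq
  obtain ⟨h1, h2⟩ := etaMat_mul_mem_Sgrp hq hqq
  refine ⟨bk q 1 1 * bk q' 0 0, _, ?_, h2, ?_⟩
  · exact fun h0 => by simpa [Matrix.det_mul, h0] using congrArg Matrix.det h1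
  · rw [← mul_assoc, etaMat_mul, h1, etaMat_one, one_mul]

theorem exists_eq_cellPt {F : Type*} [Field F] {σ x : M6 F}
    (hx : x ∈ setT (Q3 F) * {σ} * Q3 F) : ∃ h₁ h₂ a b, h₁.det ≠ 0 ∧ h₂.det ≠ 0 ∧ a ∈ Sgrp F ∧
      b ∈ Sgrp F ∧ x = aᵀ * cellPt σ h₁ h₂ * b := by
  obtain ⟨q, hq, q', hq', rfl⟩ := mem_cell_iff.1 hx
  obtain ⟨r, s, hr, hs, rfl⟩ := exists_eq_etaMat_mul hq
  obtain ⟨r', s', hr', hs', rfl⟩ := exists_eq_etaMat_mul hq'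
  refine ⟨r, r', s, s', hr, hr', hs, hs', ?_⟩
  simp only [cellPt, Matrix.transpose_mul, mul_assoc]

variable {F : Type*} [NontriviallyNormedField F] [IsUltrametricDist F]

theorem exists_eventually_eq_etaMat_mul :
    ∃ r : Qg F → M2 F, Filter.Tendsto r (𝓝 1) (𝓝 1) ∧ ∀ᶠ u : Qg F in 𝓝 1, (r u).det ≠ 0 ∧
      ∃ s, SBound 1 s ∧ (((u⁻¹ : Qg F) : GL (Fin 6) F) : M6 F) = etaMat (r u) * s := by
  let q : Qg F → M6 F := fun u => (((u⁻¹ : Qg F) : GL (Fin 6) F) : M6 F)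
  let q' : Qg F → M6 F := fun u => ((u : GL (Fin 6) F) : M6 F)
  have hq : Continuous q := Units.continuous_val.comp (continuous_subtype_val.comp continuous_inv)
  have hq' : Continuous q' := Units.continuous_val.comp continuous_subtype_val
  let r : Qg F → M2 F := fun u => bk (q u) 1 1 * bk (q' u) 0 0
  let r' : Qg F → M2 F := fun u => bk (q u) 0 0 * bk (q' u) 1 1
  have hr : Continuous r := ((continuous_bk 1 1).comp hq).matrix_mul ((continuous_bk 0 0).comp hq')
  have hr' : Continuous r' :=
    ((continuous_bk 0 0).comp hq).matrix_mul ((continuous_bk 1 1).comp hq')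
  have q1 : q 1 = 1 := by simp [q]
  have q1' : q' 1 = 1 := by simp [q']
  have r1 : r 1 = 1 := by simp [r, q1, q1', bk_one]
  have r1' : r' 1 = 1 := by simp [r', q1, q1', bk_one]
  have hqq : ∀ u, q u * q' u = 1 := fun u => (u : GL (Fin 6) F).inv_mul
  have hdec := fun u : Qg F => etaMat_mul_mem_Sgrp (u⁻¹).2 (hqq u)
  have c1 : Continuous fun u => etaMat (r' u) * q u := (continuous_etaMat.comp hr').matrix_mul hq
  have c2 : Continuous fun u => q' u * etaMat (r u) := hq'.matrix_mul (continuous_etaMat.comp hr)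
  refine ⟨r, by simpa [r1] using hr.tendsto 1, ?_⟩
  filter_upwards [eventually_near_one c1.continuousAt (by simp [r1', q1, etaMat_one]),
    eventually_near_one c2.continuousAt (by simp [r1, q1', etaMat_one])] with u e1 e2
  have h1 : r u * r' u = 1 := (hdec u).1
  refine ⟨fun h0 => by simpa [Matrix.det_mul, h0] using congrArg Matrix.det h1,
    etaMat (r' u) * q u, sBound_of_near_one (hdec u).2 ?_ e1 e2, ?_⟩
  · rw [mul_assoc, ← mul_assoc (q u), hqq, one_mul, etaMat_mul, _root_.mul_eq_one_comm.1 h1,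
      etaMat_one]
  · rw [← mul_assoc, etaMat_mul, h1, etaMat_one, one_mul]

theorem eventually_eq_cellPt [ProperSpace F] {σ : M6 F} [LocallyCompactSpace (Cell σ)]
    {P : M2 F → M2 F → Prop} {h₁ h₂ : M2 F} (d₁ : h₁.det ≠ 0) (d₂ : h₂.det ≠ 0)
    (hP : ∀ᶠ p in 𝓝 (h₁, h₂), P p.1 p.2) {x₀ : Cell σ} (hx₀ : x₀.1 = cellPt σ h₁ h₂) :
    ∀ᶠ x in 𝓝 x₀, ∃ k₁ k₂ a b, P k₁ k₂ ∧ k₁.det ≠ 0 ∧ k₂.det ≠ 0 ∧ SBound 1 a ∧ SBound 1 b ∧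
      x.1 = aᵀ * cellPt σ k₁ k₂ * b := by
  obtain ⟨r, hr, hs⟩ := exists_eventually_eq_etaMat_mul (F := F)
  have hfst : Filter.Tendsto (Prod.fst : Qg F × Qg F → Qg F) (𝓝 1) (𝓝 1) :=
    continuous_fst.tendsto (1 : Qg F × Qg F)
  have hsnd : Filter.Tendsto (Prod.snd : Qg F × Qg F → Qg F) (𝓝 1) (𝓝 1) :=
    continuous_snd.tendsto (1 : Qg F × Qg F)
  have ht : Filter.Tendsto (fun γ : Qg F × Qg F => (h₁ * r γ.1, h₂ * r γ.2)) (𝓝 1)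
      (𝓝 (h₁, h₂)) := by
    have e1 := (hr.comp hfst).const_mul h₁
    have e2 := (hr.comp hsnd).const_mul h₂
    rw [mul_one] at e1 e2
    exact e1.prodMk_nhds e2
  have hopen := (isOpenMap_smul_of_sigmaCompact (G := Qg F × Qg F) x₀).image_mem_nhds
    ((ht.eventually hP).and ((hfst.eventually hs).and (hsnd.eventually hs)))
  rw [one_smul] at hopen
  filter_upwards [hopen]
  rintro _ ⟨γ, ⟨g1, ⟨g2, s, hs1, g3⟩, g4, s', hs2, g5⟩, rfl⟩
  refine ⟨_, _, s, s', g1, ?_, ?_, hs1, hs2, ?_⟩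
  · rw [Matrix.det_mul]
    exact mul_ne_zero d₁ g2
  · rw [Matrix.det_mul]
    exact mul_ne_zero d₂ g4
  · change ((γ • x₀ : Cell σ) : M6 F) = _
    rw [coe_smul_cell, hx₀, g3, g5, cellPt, cellPt, ← etaMat_mul, ← etaMat_mul]
    simp only [Matrix.transpose_mul, mul_assoc]

end CellPoints

section Families

variable {F : Type*} [Field F]

/-- A one-parameter family in the stabiliser of `σ` in the unipotent radicals. -/
structure IsFam (σ : M6 F) (X₁ Z₁ X₂ Z₂ : M2 F) : Prop where
  trace_left : Z₁.trace = 0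
  det_left : X₁.det = 0
  trace_right : Z₂.trace = 0
  det_right : X₂.det = 0
  stab : ∀ c : F, (Umat (c • X₁) (-(c • X₁).adjugate) (c • Z₁))ᵀ * σ *
    Umat (c • X₂) (-(c • X₂).adjugate) (c • Z₂) = σ

/-- The character condition for an element `η(h₁)ᵀ σ η(h₂)` to be relevant. -/
def Good (σ : M6 F) (h₁ h₂ : M2 F) : Prop :=
  ∀ X₁ Z₁ X₂ Z₂ : M2 F, IsFam σ X₁ Z₁ X₂ Z₂ → (X₁ * h₁).trace + (X₂ * h₂).trace = 0

theorem etaMat_mul_umat (h X Z : M2 F) :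
    etaMat h * Umat (X * h) (-(X * h).adjugate) (h.det • Z) =
      Umat X (-X.adjugate) Z * etaMat h := by
  rw [etaMat, bdiag, Umat, Umat, blk_mul, blk_mul, blk_inj]
  simp [Matrix.adjugate_mul_distrib, ← mul_assoc, Matrix.mul_adjugate]

theorem transpose_mul_cellPt_mul {σ : M6 F} {X₁ Z₁ X₂ Z₂ h₁ h₂ : M2 F}
    (hf : IsFam σ X₁ Z₁ X₂ Z₂)
    (c : F) :
    (Umat (c • X₁ * h₁) (-(c • X₁ * h₁).adjugate) (h₁.det • c • Z₁))ᵀ * cellPt σ h₁ h₂ *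
      Umat (c • X₂ * h₂) (-(c • X₂ * h₂).adjugate) (h₂.det • c • Z₂) = cellPt σ h₁ h₂ := by
  have e : (etaMat h₁ * Umat (c • X₁ * h₁) (-(c • X₁ * h₁).adjugate) (h₁.det • c • Z₁))ᵀ * σ *
      (etaMat h₂ * Umat (c • X₂ * h₂) (-(c • X₂ * h₂).adjugate) (h₂.det • c • Z₂)) =
      cellPt σ h₁ h₂ := by
    rw [etaMat_mul_umat, etaMat_mul_umat, Matrix.transpose_mul]
    have h := congrArg (fun m => (etaMat h₁)ᵀ * m * etaMat h₂) (hf.stab c)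
    simp only [mul_assoc] at h
    simpa only [cellPt, mul_assoc] using h
  rw [Matrix.transpose_mul] at e
  simpa only [cellPt, mul_assoc] using e

theorem IsFam.trace_eq {σ : M6 F} {X₁ Z₁ X₂ Z₂ h₁ h₂ : M2 F}
    (hf : IsFam σ X₁ Z₁ X₂ Z₂) (c : F) :
    (h₁.det • c • Z₁).trace = -(c • X₁ * h₁).det ∧
      (h₂.det • c • Z₂).trace = -(c • X₂ * h₂).det := by
  simp [Matrix.trace_smul, Matrix.det_mul, hf.trace_left, hf.trace_right,
    hf.det_left, hf.det_right]

end Families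

section Bounds

variable {F : Type*} [NontriviallyNormedField F]

theorem eventually_entryLe {Y : Type*} [TopologicalSpace Y] {f : Y → M2 F} {y₀ : Y}
    (hf : ContinuousAt f y₀) : ∃ C : ℝ, 1 ≤ C ∧ ∀ C', C ≤ C' → ∀ᶠ y in 𝓝 y₀, EntryLe C' (f y) := by
  have hc : ∀ i j, ContinuousAt (fun y => ‖f y i j‖) y₀ := fun i j =>
    ((continuous_id.matrix_elem i j).continuousAt.comp hf).norm
  refine ⟨1 + ∑ i, ∑ j, ‖f y₀ i j‖, le_add_of_nonneg_right (by positivity), fun C' hC' => ?_⟩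
  rw [show (∀ᶠ y in 𝓝 y₀, EntryLe C' (f y)) ↔ ∀ᶠ y in 𝓝 y₀, ∀ i j, ‖f y i j‖ ≤ C' from Iff.rfl,
    Filter.eventually_all]
  intro i
  rw [Filter.eventually_all]
  intro j
  refine ((hc i j).eventually_lt_const (u := C') ?_).mono fun y hy => hy.le
  have h1 : ‖f y₀ i j‖ ≤ ∑ j, ‖f y₀ i j‖ :=
    Finset.single_le_sum (f := fun j => ‖f y₀ i j‖) (fun _ _ => norm_nonneg _) (Finset.mem_univ j)
  have h2 : ∑ j, ‖f y₀ i j‖ ≤ ∑ i, ∑ j, ‖f y₀ i j‖ :=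
    Finset.single_le_sum (f := fun i => ∑ j, ‖f y₀ i j‖)
      (fun _ _ => Finset.sum_nonneg fun _ _ => norm_nonneg _) (Finset.mem_univ i)
  linarith

theorem EntryLe.mono {c d : ℝ} (hcd : c ≤ d) {m : M2 F} (h : EntryLe c m) : EntryLe d m :=
  fun i j => (h i j).trans hcd

theorem WBound.of_one {m : M6 F} (hm : m ∈ Q3 F) (h : WBound 1 m) {C : ℝ} (hC : 1 ≤ C) :
    WBound C m := by
  intro i j
  have hij := h i j
  rw [one_pow, one_pow, mul_one] at hij
  by_cases hlt : i.val / 2 ≤ j.val / 2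
  · calc ‖m i j‖ * C ^ (i.val / 2) ≤ 1 * C ^ (i.val / 2) := by gcongr
      _ ≤ C ^ (j.val / 2) := by
        rw [one_mul]
        exact pow_le_pow_right₀ hC hlt
  · have h0 : m i j = 0 := by
      obtain ⟨⟨h1, h2, h3⟩, -⟩ := mem_Q3_iff_sympAdj.1 hm
      obtain ⟨a, b, c, d, e, f, g, g', i', rfl⟩ := exists_eq_blk m
      simp only [bk_blk] at h1 h2 h3
      have h1 : d = 0 := h1
      have h2 : g = 0 := h2
      have h3 : g' = 0 := h3
      subst h1 h2 h3
      fin_cases i <;> fin_cases j <;> first | rfl | (exact absurd (by decide) hlt)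
    rw [h0, norm_zero, zero_mul]
    positivity

theorem SBound.of_one {a : M6 F} (h : SBound 1 a) {C : ℝ} (hC : 1 ≤ C) : SBound C a := by
  obtain ⟨h1, a', h2, h3, h4⟩ := h
  exact ⟨h1, a', h2, h3.of_one (sgrp_subset_Q3 h1) hC,
    h4.of_one (mem_Q3_of_mul_eq_one (sgrp_subset_Q3 h1) h2).1 hC⟩

end Bounds

section Reduction

variable {F : Type*} [NontriviallyNormedField F]

theorem OddShalika.vanishesNear_of_translate {ψS : M6 F → ℂˣ} {σ : M6 F}
    {hσ : σᵀ ∈ setT (Q3 F) * {σ} * Q3 F} {T : testFun (Cell σ) →ₗ[ℂ] ℂ} (hT : OddShalika ψS hσ T)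
    {x y : Cell σ} {a b : M6 F} (ha : a ∈ Sgrp F) (hb : b ∈ Sgrp F) (hxy : y.1 = aᵀ * x.1 * b)
    (hx : VanishesNear T x) : VanishesNear T y := by
  obtain ⟨a', haa⟩ := exists_mul_eq_one_of_mem_Q3 (sgrp_subset_Q3 ha)
  obtain ⟨b', hbb⟩ := exists_mul_eq_one_of_mem_Q3 (sgrp_subset_Q3 hb)
  obtain ⟨u, rfl, -⟩ := exists_gl haa
  obtain ⟨v, rfl, -⟩ := exists_gl hbb
  let γ : Qg F × Qg F := (⟨u, sgrp_subset_Q3 ha⟩⁻¹, ⟨v, sgrp_subset_Q3 hb⟩⁻¹)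
  have e : y = Homeomorph.smul γ x := Subtype.ext (by
    rw [hxy]
    change _ = ((γ • x : Cell σ) : M6 F)
    rw [coe_smul_cell]
    simp only [γ, inv_inv])
  rw [e]
  refine vanishesNear_of_homeomorph (Homeomorph.smul γ)
    (ψS ((γ.1 : GL (Fin 6) F) : M6 F) * ψS ((γ.2 : GL (Fin 6) F) : M6 F)) ?_ (by simp) hx
  intro f f' hf
  exact (hT.smul γ.1 γ.2 ((Sg F).inv_mem ha) ((Sg F).inv_mem hb) f f' hf).symm

variable [IsUltrametricDist F]

/-- Near `(h₁, h₂)`, the relevant elements `η(k₁)ᵀ σ η(k₂)` are symmetric up to a bounded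
translation by the Shalika group. -/
def LocSymm (σ : M6 F) (h₁ h₂ : M2 F) : Prop :=
  ∃ C : ℝ, 1 ≤ C ∧ ∀ᶠ p in 𝓝 (h₁, h₂), p.1.det ≠ 0 → p.2.det ≠ 0 → Good σ p.1 p.2 →
    ∃ a b, SBound C a ∧ SBound C b ∧
      (aᵀ * cellPt σ p.1 p.2 * b)ᵀ = aᵀ * cellPt σ p.1 p.2 * b

variable [ProperSpace F] {ψk : F → ℂˣ} {ψS : M6 F → ℂˣ} {σ : M6 F}
  {hσ : σᵀ ∈ setT (Q3 F) * {σ} * Q3 F} {T : testFun (Cell σ) →ₗ[ℂ] ℂ}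

theorem OddShalika.vanishesNear_of_not_good [LocallyCompactSpace (Cell σ)]
    (hψk : ∀ x y : F, ψk (x + y) = ψk x * ψk y) (hlc : IsLocallyConstant ψk)
    (hψS : IsShalikaCharacter ψk ψS) (hT : OddShalika ψS hσ T)
    (hnt : ∃ x : F, ψk x ≠ 1) {h₁ h₂ : M2 F} (d₁ : h₁.det ≠ 0) (d₂ : h₂.det ≠ 0)
    (hg : ¬Good σ h₁ h₂) {x₀ : Cell σ} (hx₀ : x₀.1 = cellPt σ h₁ h₂) : VanishesNear T x₀ := by
  simp only [Good, not_forall] at hg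
  obtain ⟨X₁, Z₁, X₂, Z₂, hf, hne⟩ := hg
  obtain ⟨c₀, hc₀⟩ := hnt
  let t : M2 F × M2 F → F := fun p => (X₁ * p.1).trace + (X₂ * p.2).trace
  have ht : Continuous t := by fun_prop
  let c : M2 F × M2 F → F := fun p => -c₀ / t p
  have hc : ContinuousAt c (h₁, h₂) := continuousAt_const.div ht.continuousAt hne
  obtain ⟨C1, hC1, b1⟩ := eventually_entryLe (y₀ := (h₁, h₂)) (f := fun p => c p • X₁ * p.1)
    (by fun_prop)
  obtain ⟨C2, hC2, b2⟩ := eventually_entryLe (y₀ := (h₁, h₂)) (f := fun p => c p • X₂ * p.2)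
    (by fun_prop)
  obtain ⟨C3, hC3, b3⟩ := eventually_entryLe (y₀ := (h₁, h₂)) (f := fun p => p.1.det • c p • Z₁)
    (by fun_prop)
  obtain ⟨C4, hC4, b4⟩ := eventually_entryLe (y₀ := (h₁, h₂)) (f := fun p => p.2.det • c p • Z₂)
    (by fun_prop)
  let C := max (max C1 C2) (max C3 C4)
  have hC : 1 ≤ C := hC1.trans ((le_max_left _ _).trans (le_max_left _ _))
  have hCC : C ≤ C ^ 2 := le_self_pow₀ hC two_ne_zero
  have hev := ((ht.continuousAt.eventually_ne (x := (h₁, h₂)) hne).and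
    ((b1 C ((le_max_left _ _).trans (le_max_left _ _))).and
    ((b2 C ((le_max_right _ _).trans (le_max_left _ _))).and
    ((b3 (C ^ 2) (((le_max_left _ _).trans (le_max_right _ _)).trans hCC)).and
    (b4 (C ^ 2) (((le_max_right _ _).trans (le_max_right _ _)).trans hCC))))))
  refine hT.vanishesNear hψk hlc hψS hC ?_
  filter_upwards [eventually_eq_cellPt (P := fun k₁ k₂ => t (k₁, k₂) ≠ 0 ∧
    EntryLe C (c (k₁, k₂) • X₁ * k₁) ∧ EntryLe C (c (k₁, k₂) • X₂ * k₂) ∧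
    EntryLe (C ^ 2) (k₁.det • c (k₁, k₂) • Z₁) ∧ EntryLe (C ^ 2) (k₂.det • c (k₁, k₂) • Z₂))
    d₁ d₂ hev hx₀]
  rintro x ⟨k₁, k₂, a, b, ⟨hk, e1, e2, e3, e4⟩, dk₁, dk₂, ha, hb, hx⟩
  refine Or.inr fun f hf1 _ => ?_
  let y : Cell σ := ⟨_, cellPt_mem σ dk₁ dk₂⟩
  obtain ⟨s1, s2⟩ := hf.trace_eq (h₁ := k₁) (h₂ := k₂) (c (k₁, k₂))
  have hy := hf1 _ _ (sBound_umat hC s1 e1 e3) (sBound_umat hC s2 e2 e4) y y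
    (transpose_mul_cellPt_mul hf _).symm
  rw [shalikaCharacter_umat hψS s1, shalikaCharacter_umat hψS s2, ← Units.val_mul, ← hψk] at hy
  have hsum : -(c (k₁, k₂) • X₁ * k₁).trace + -(c (k₁, k₂) • X₂ * k₂).trace = c₀ := by
    have e : c (k₁, k₂) * t (k₁, k₂) = -c₀ := div_mul_cancel₀ _ hk
    rw [Matrix.smul_mul, Matrix.smul_mul, Matrix.trace_smul, Matrix.trace_smul, smul_eq_mul,
      smul_eq_mul, ← neg_add, ← mul_add]
    exact neg_eq_iff_eq_neg.2 e
  rw [hsum] at hy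
  have hy0 : f y = 0 := by
    by_contra h0
    exact hc₀ (Units.ext (mul_eq_right₀ h0 |>.1 hy.symm))
  have hxy := hf1 a b (ha.of_one hC) (hb.of_one hC) y x hx
  rw [hy0] at hxy
  simpa using hxy.symm

theorem OddShalika.vanishesNear_of_locSymm [LocallyCompactSpace (Cell σ)]
    (hψk : ∀ x y : F, ψk (x + y) = ψk x * ψk y) (hlc : IsLocallyConstant ψk)
    (hψS : IsShalikaCharacter ψk ψS) (hT : OddShalika ψS hσ T)
    (hnt : ∃ x : F, ψk x ≠ 1) {h₁ h₂ : M2 F} (d₁ : h₁.det ≠ 0) (d₂ : h₂.det ≠ 0)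
    (hs : LocSymm σ h₁ h₂) {x₀ : Cell σ} (hx₀ : x₀.1 = cellPt σ h₁ h₂) : VanishesNear T x₀ := by
  obtain ⟨C, hC, hev⟩ := hs
  refine hT.vanishesNear hψk hlc hψS hC ?_
  filter_upwards [eventually_eq_cellPt (P := fun k₁ k₂ => k₁.det ≠ 0 → k₂.det ≠ 0 →
    Good σ k₁ k₂ → ∃ a b, SBound C a ∧ SBound C b ∧
      (aᵀ * cellPt σ k₁ k₂ * b)ᵀ = aᵀ * cellPt σ k₁ k₂ * b) d₁ d₂ hev hx₀]
  rintro x ⟨k₁, k₂, a, b, hP, dk₁, dk₂, ha, hb, hx⟩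
  let y : Cell σ := ⟨_, cellPt_mem σ dk₁ dk₂⟩
  by_cases hg : Good σ k₁ k₂
  · obtain ⟨a', b', ha', hb', hsym⟩ := hP dk₁ dk₂ hg
    refine Or.inr fun f hf1 hf2 => ?_
    let z : Cell σ := ⟨_, mul_mem_cell (sgrp_subset_Q3 ha'.1) (sgrp_subset_Q3 hb'.1) y.2⟩
    have hz : f z = 0 := by
      have := hf2 z z hsym.symm
      exact CharZero.eq_neg_self_iff.1 this
    have hy0 : f y = 0 := by
      rw [hf1 a' b' ha' hb' y z rfl, hz, mul_zero]
    have hxy := hf1 a b (ha.of_one hC) (hb.of_one hC) y x hx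
    rw [hy0] at hxy
    simpa using hxy.symm
  · exact Or.inl (hT.vanishesNear_of_translate (x := y) ha.1 hb.1 hx
      (hT.vanishesNear_of_not_good hψk hlc hψS hnt dk₁ dk₂ hg rfl))

theorem OddShalika.vanishesNear_of_forall_good [LocallyCompactSpace (Cell σ)]
    (hψk : ∀ x y : F, ψk (x + y) = ψk x * ψk y) (hlc : IsLocallyConstant ψk)
    (hψS : IsShalikaCharacter ψk ψS) (hT : OddShalika ψS hσ T)
    (hnt : ∃ x : F, ψk x ≠ 1)
    (H : ∀ h₁ h₂ : M2 F, h₁.det ≠ 0 → h₂.det ≠ 0 → Good σ h₁ h₂ →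
      ∃ k₁ k₂ a b, k₁.det ≠ 0 ∧ k₂.det ≠ 0 ∧ a ∈ Sgrp F ∧ b ∈ Sgrp F ∧
        cellPt σ h₁ h₂ = aᵀ * cellPt σ k₁ k₂ * b ∧ LocSymm σ k₁ k₂) (x : Cell σ) :
    VanishesNear T x := by
  obtain ⟨h₁, h₂, a, b, d₁, d₂, ha, hb, hx⟩ := exists_eq_cellPt x.2
  refine hT.vanishesNear_of_translate (x := ⟨_, cellPt_mem σ d₁ d₂⟩) ha hb hx ?_
  by_cases hg : Good σ h₁ h₂
  · obtain ⟨k₁, k₂, a', b', e₁, e₂, ha', hb', he, hs⟩ := H h₁ h₂ d₁ d₂ hg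
    exact hT.vanishesNear_of_translate (x := ⟨_, cellPt_mem σ e₁ e₂⟩) ha' hb' he
      (hT.vanishesNear_of_locSymm hψk hlc hψS hnt e₁ e₂ hs rfl)
  · exact hT.vanishesNear_of_not_good hψk hlc hψS hnt d₁ d₂ hg rfl

end Reduction

section Main

theorem locallyCompactSpace_of_isPretransitive {G X : Type*} [Group G] [TopologicalSpace X]
    [T2Space X] [MulAction G X] [ContinuousConstSMul G X] [MulAction.IsPretransitive G X]
    {f : X → ℂ} (hf : f ∈ testFun X) {x : X} (hx : f x ≠ 0) : LocallyCompactSpace X := by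
  have : WeaklyLocallyCompactSpace X := ⟨fun y => by
    obtain ⟨γ, rfl⟩ := MulAction.exists_smul_eq G x y
    refine ⟨_, (isCompact_support_of_mem_testFun hf).image (continuous_const_smul γ), ?_⟩
    exact (Homeomorph.smul γ).isOpenMap.image_mem_nhds
      ((isClopen_support_of_mem_testFun hf).isOpen.mem_nhds hx)⟩
  infer_instance

variable {F : Type*} [NontriviallyNormedField F]

/-- The restriction of an invariant distribution to test functions, as a linear map. -/
def IsInvariantDistrib.linearMap {ψS : M6 F → ℂˣ} {R : Set (M6 F)}
    {T : ({m : M6 F // m ∈ R} → ℂ) → ℂ} (hT : IsInvariantDistrib ψS R T) :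
    testFun {m : M6 F // m ∈ R} →ₗ[ℂ] ℂ where
  toFun f := T f.1
  map_add' f g := hT.1 f.1 g.1 f.2 g.2
  map_smul' c f := hT.2.1 c f.1 f.2

theorem IsInvariantDistrib.map_smul_smul {ψk : F → ℂˣ} {ψS : M6 F → ℂˣ}
    (hψS : IsShalikaCharacter ψk ψS) {σ : M6 F} {T : (Cell σ → ℂ) → ℂ}
    (hT : IsInvariantDistrib ψS (setT (Q3 F) * {σ} * Q3 F) T) {a b : Qg F}
    (ha : (a : GL (Fin 6) F) ∈ Sg F) (hb : (b : GL (Fin 6) F) ∈ Sg F) {f f' : Cell σ → ℂ}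
    (hf : f ∈ testFun (Cell σ)) (hf' : f' ∈ testFun (Cell σ))
    (h : ∀ x, f' x = f ((a, b) • x)) :
    T f' = ψS ((a : GL (Fin 6) F) : M6 F) * ψS ((b : GL (Fin 6) F) : M6 F) * T f := by
  have hb' := (Sg F).inv_mem hb
  have e1 : (ψS (((b : GL (Fin 6) F)⁻¹ : GL (Fin 6) F) : M6 F))⁻¹ =
      ψS ((b : GL (Fin 6) F) : M6 F) := by
    rw [inv_eq_iff_mul_eq_one, ← hψS.1 _ hb' _ hb, Units.inv_mul, shalikaCharacter_one hψS]
  rw [hT.2.2 _ ⟨_, ha, rfl⟩ _ hb' f f' hf hf' ?_, Matrix.transpose_transpose,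
    ← Units.val_inv_eq_inv_val, e1]
  intro x hx hx'
  rw [h]
  congr 1
  refine Subtype.ext ?_
  rw [coe_smul_cell]
  simp [Matrix.transpose_nonsing_inv]

theorem IsInvariantDistrib.transpose_eq [IsUltrametricDist F] [ProperSpace F] {ψk : F → ℂˣ}
    {ψS : M6 F → ℂˣ} (hψk : ∀ x y : F, ψk (x + y) = ψk x * ψk y) (hlc : IsLocallyConstant ψk)
    (hnt : ∃ x : F, ψk x ≠ 1) (hψS : IsShalikaCharacter ψk ψS) {σ : M6 F}
    (hσ : σᵀ ∈ setT (Q3 F) * {σ} * Q3 F)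
    (H : ∀ h₁ h₂ : M2 F, h₁.det ≠ 0 → h₂.det ≠ 0 → Good σ h₁ h₂ →
      ∃ k₁ k₂ a b, k₁.det ≠ 0 ∧ k₂.det ≠ 0 ∧ a ∈ Sgrp F ∧ b ∈ Sgrp F ∧
        cellPt σ h₁ h₂ = aᵀ * cellPt σ k₁ k₂ * b ∧ LocSymm σ k₁ k₂)
    {T : (Cell σ → ℂ) → ℂ} (hT : IsInvariantDistrib ψS (setT (Q3 F) * {σ} * Q3 F) T)
    {f f' : Cell σ → ℂ} (hf : f ∈ testFun (Cell σ))
    (h : ∀ x, f' x = f (transposeCell hσ x)) : T f' = T f := by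
  by_cases hz : ∀ x, f x = 0
  · have e : f' = f := funext fun x => by rw [h, hz, hz]
    rw [e]
  push Not at hz
  obtain ⟨x, hx⟩ := hz
  have := locallyCompactSpace_of_isPretransitive (G := Qg F × Qg F) hf hx
  have : TotallyDisconnectedSpace (M6 F) :=
    inferInstanceAs (TotallyDisconnectedSpace (Fin 6 → Fin 6 → F))
  let τ : testFun (Cell σ) →ₗ[ℂ] testFun (Cell σ) :=
    { toFun := fun f => ⟨_, comp_homeomorph_mem_testFun f.2 (transposeHomeo hσ)⟩
      map_add' := fun _ _ => rfl
      map_smul' := fun _ _ => rfl }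
  have hτ : ∀ (f : testFun (Cell σ)) x, (τ f).1 x = f.1 (transposeCell hσ x) := fun _ _ => rfl
  have hττ : ∀ x, transposeCell hσ (transposeCell hσ x) = x := fun x =>
    Subtype.ext (Matrix.transpose_transpose x.1)
  let T' : testFun (Cell σ) →ₗ[ℂ] ℂ := hT.linearMap - hT.linearMap ∘ₗ τ
  have hT' : ∀ f, T' f = T f.1 - T (τ f).1 := fun _ => rfl
  have hodd : OddShalika ψS hσ T' := by
    constructor
    · intro a b ha hb f f' hff
      rw [hT', hT', hT.map_smul_smul hψS ha hb f.2 f'.2 hff,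
        hT.map_smul_smul hψS hb ha (τ f).2 (τ f').2 ?_]
      · ring
      · intro x
        rw [hτ, hτ, hff]
        refine congrArg f.1 (Subtype.ext ?_)
        change (((a⁻¹ : Qg F) : GL (Fin 6) F) : M6 F)ᵀ * x.1ᵀ *
          (((b⁻¹ : Qg F) : GL (Fin 6) F) : M6 F) = ((((b⁻¹ : Qg F) : GL (Fin 6) F) : M6 F)ᵀ *
          x.1 * (((a⁻¹ : Qg F) : GL (Fin 6) F) : M6 F))ᵀ
        simp only [Matrix.transpose_mul, Matrix.transpose_transpose, mul_assoc]
    · intro f f' hff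
      have e1 : f' = τ f := Subtype.ext (funext hff)
      have e2 : τ f' = f := Subtype.ext (funext fun x => by rw [hτ, hff, hττ])
      rw [hT', hT', e2, e1, neg_sub]
  have hv := eq_zero_of_vanishesNear_support T' ⟨f, hf⟩ fun x _ =>
    hodd.vanishesNear_of_forall_good hψk hlc hψS hnt H x
  rw [hT', sub_eq_zero] at hv
  have e : f' = (τ ⟨f, hf⟩).1 := funext h
  rw [e]
  exact hv.symm

end Main

section CellTools

theorem cellPt_blk {F : Type*} [Field F] (h₁ h₂ a b c d e f g h i : M2 F) :
    cellPt (blk ![![a, b, c], ![d, e, f], ![g, h, i]]) h₁ h₂ =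
      blk ![![a, b * h₂, h₂.det • c],
        ![h₁ᵀ * d, h₁ᵀ * e * h₂, h₂.det • (h₁ᵀ * f)],
        ![h₁.det • g, h₁.det • (h * h₂), h₁.det • h₂.det • i]] := by
  rw [cellPt, etaMat, etaMat, bdiag, bdiag, blk_transpose, blk_mul, blk_mul, blk_inj]
  simp [smul_smul, mul_comm]

/-- Equivalence under translation by the Shalika group. -/
def Translate {F : Type*} [Field F] (m n : M6 F) : Prop :=
  ∃ a b, a ∈ Sgrp F ∧ b ∈ Sgrp F ∧ m = aᵀ * n * b

theorem Translate.trans {F : Type*} [Field F] {l m n : M6 F} (h : Translate l m)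
    (h' : Translate m n) : Translate l n := by
  obtain ⟨a, b, ha, hb, rfl⟩ := h
  obtain ⟨c, d, hc, hd, rfl⟩ := h'
  refine ⟨c * a, d * b, mul_mem_Sgrp hc ha, mul_mem_Sgrp hd hb, ?_⟩
  simp only [Matrix.transpose_mul, mul_assoc]

theorem Translate.transpose {F : Type*} [Field F] {m n : M6 F} (h : Translate m n) :
    Translate mᵀ nᵀ := by
  obtain ⟨a, b, ha, hb, rfl⟩ := h
  refine ⟨b, a, hb, ha, ?_⟩
  simp only [Matrix.transpose_mul, Matrix.transpose_transpose, mul_assoc]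

theorem Translate.refl {F : Type*} [Field F] (m : M6 F) : Translate m m :=
  ⟨1, 1, one_mem_Sgrp, one_mem_Sgrp, by simp⟩

theorem translate_of_dmat {F : Type*} [Field F] {m n : M6 F} {g : M2 F} (hg : g.det ≠ 0)
    (h : m = Dmat g * n) : Translate m n := by
  refine ⟨Dmat gᵀ, 1, dmat_mem_Sgrp (by rwa [Matrix.det_transpose]), one_mem_Sgrp, ?_⟩
  rw [h, mul_one, Dmat, Dmat, bdiag, bdiag, blk_transpose]
  simp

theorem transpose_mem_cell {F : Type*} [Field F] {σ d : M6 F} (hd : d ∈ Q3 F) (hdt : dᵀ = d)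
    (h : σᵀ = d * σ * d) : σᵀ ∈ setT (Q3 F) * {σ} * Q3 F :=
  mem_cell_iff.2 ⟨d, hd, d, hd, by rw [h, hdt]⟩

theorem sBound_diag {F : Type*} [NontriviallyNormedField F] {C : ℝ} (hC : 1 ≤ C) {β : F}
    (hβ : ‖β‖ = 1) :
    SBound C (Dmat !![1, 0; 0, β]) :=
  sBound_dmat hC (entryLe_fin_two (by simp) (by simp) (by simp) hβ.le)
    (by rw [Matrix.det_fin_two_of]; simpa using hβ)

variable {F : Type*} [NontriviallyNormedField F] [IsUltrametricDist F]

theorem norm_eq_of_norm_sub_lt {x y : F} (h : ‖x - y‖ < ‖y‖) : ‖x‖ = ‖y‖ := by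
  refine le_antisymm ?_ ?_
  · have := IsUltrametricDist.norm_add_le_max (x - y) y
    rw [sub_add_cancel] at this
    exact this.trans (max_le h.le le_rfl)
  · have := norm_sub_le_max' x (x - y)
    rw [sub_sub_cancel] at this
    rcases le_max_iff.1 this with h' | h'
    · exact h'
    · exact absurd h' (not_le.2 h)

theorem eventually_norm_eq {Y : Type*} [TopologicalSpace Y] {f : Y → F} {y₀ : Y}
    (hf : ContinuousAt f y₀) (h : f y₀ ≠ 0) : ∀ᶠ y in 𝓝 y₀, ‖f y‖ = ‖f y₀‖ := by
  have hc : ContinuousAt (fun y => ‖f y - f y₀‖) y₀ := (hf.sub continuousAt_const).norm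
  have h' := hc.eventually_lt_const (u := ‖f y₀‖) (by simpa using h)
  filter_upwards [h'] with y hy
  exact norm_eq_of_norm_sub_lt hy

/-- Local symmetrisation by unipotent elements in the centre and diagonal elements. -/
theorem locSymm_of {σ : M6 F} {h₁ h₂ : M2 F} {Z₁ Z₂ : M2 F × M2 F → M2 F}
    {β₁ β₂ : M2 F × M2 F → F} (hZ₁ : ContinuousAt Z₁ (h₁, h₂)) (hZ₂ : ContinuousAt Z₂ (h₁, h₂))
    (t₁ : ∀ p, (Z₁ p).trace = 0) (t₂ : ∀ p, (Z₂ p).trace = 0)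
    (hβ₁ : ContinuousAt β₁ (h₁, h₂)) (hβ₂ : ContinuousAt β₂ (h₁, h₂))
    (n₁ : ‖β₁ (h₁, h₂)‖ = 1) (n₂ : ‖β₂ (h₁, h₂)‖ = 1)
    (H : ∀ p : M2 F × M2 F, p.1.det ≠ 0 → p.2.det ≠ 0 → β₁ p ≠ 0 → β₂ p ≠ 0 → Good σ p.1 p.2 →
      ((Umat 0 0 (Z₁ p) * Dmat !![1, 0; 0, β₁ p])ᵀ * cellPt σ p.1 p.2 *
        (Umat 0 0 (Z₂ p) * Dmat !![1, 0; 0, β₂ p]))ᵀ =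
      (Umat 0 0 (Z₁ p) * Dmat !![1, 0; 0, β₁ p])ᵀ * cellPt σ p.1 p.2 *
        (Umat 0 0 (Z₂ p) * Dmat !![1, 0; 0, β₂ p])) : LocSymm σ h₁ h₂ := by
  obtain ⟨C₁, hC₁, b₁⟩ := eventually_entryLe hZ₁
  obtain ⟨C₂, hC₂, b₂⟩ := eventually_entryLe hZ₂
  let C := max C₁ C₂
  have hC : 1 ≤ C := hC₁.trans (le_max_left _ _)
  have hCC : C ≤ C ^ 2 := le_self_pow₀ hC two_ne_zero
  have e₁ : β₁ (h₁, h₂) ≠ 0 := norm_ne_zero_iff.1 (by simp [n₁])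
  have e₂ : β₂ (h₁, h₂) ≠ 0 := norm_ne_zero_iff.1 (by simp [n₂])
  refine ⟨C, hC, ?_⟩
  filter_upwards [b₁ (C ^ 2) ((le_max_left _ _).trans hCC), b₂ (C ^ 2)
    ((le_max_right _ _).trans hCC), eventually_norm_eq hβ₁ e₁, eventually_norm_eq hβ₂ e₂]
    with p z₁ z₂ m₁ m₂ dp₁ dp₂ hg
  rw [n₁] at m₁
  rw [n₂] at m₂
  have key : ∀ Z : M2 F, Z.trace = 0 → EntryLe (C ^ 2) Z → SBound C (Umat 0 0 Z) := by
    intro Z hZ hZC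
    have := sBound_umat hC (X := 0) (Z := Z) (by simp [hZ]) (entryLe_zero (by linarith)) hZC
    simpa using this
  exact ⟨_, _, (key _ (t₁ p) z₁).mul hC (sBound_diag hC m₁),
    (key _ (t₂ p) z₂).mul hC (sBound_diag hC m₂),
    H p dp₁ dp₂ (norm_ne_zero_iff.1 (by simp [m₁])) (norm_ne_zero_iff.1 (by simp [m₂])) hg⟩

end CellTools

section IdentityCell

theorem one_transpose_mem_cell {F : Type*} [Field F] : (1 : M6 F)ᵀ ∈ setT (Q3 F) * {1} * Q3 F :=
  transpose_mem_cell one_mem_Q3 (by simp) (by simp)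

variable {F : Type*} [NontriviallyNormedField F] [IsUltrametricDist F]

theorem exists_symm_mul_symm (y : M2 F) :
    ∃ g : M2 F, gᵀ = g ∧ EntryLe 1 g ∧ ‖g.det‖ = 1 ∧ (g * y)ᵀ = g * y := by
  obtain ⟨a, b, c, d, rfl⟩ := exists_eq_fin_two y
  suffices ∃ p q r : F, ‖p‖ ≤ 1 ∧ ‖q‖ ≤ 1 ∧ ‖r‖ ≤ 1 ∧ ‖p * r - q * q‖ = 1 ∧
      p * b + q * d = q * a + r * c by
    obtain ⟨p, q, r, hp, hq, hr, hd, h⟩ := this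
    refine ⟨!![p, q; q, r], by rw [transpose_of_fin_two], entryLe_fin_two hp hq hq hr,
      by rw [Matrix.det_fin_two_of, hd], ?_⟩
    rw [Matrix.mul_fin_two, transpose_of_fin_two, h]
  by_cases h1 : ‖b‖ < ‖d - a‖ ∧ ‖c‖ < ‖d - a‖
  · have h0 : d - a ≠ 0 := norm_pos_iff.1 ((norm_nonneg _).trans_lt h1.1)
    have hq : ‖(c - b) / (d - a)‖ < 1 := by
      rw [norm_div, div_lt_one (norm_pos_iff.2 h0)]
      exact (norm_sub_le_max' _ _).trans_lt (max_lt h1.2 h1.1)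
    refine ⟨1, (c - b) / (d - a), 1, by simp, hq.le, by simp, ?_, by field_simp; ring⟩
    rw [← norm_one (α := F)]
    refine norm_eq_of_norm_sub_lt ?_
    rw [show (1 : F) * 1 - (c - b) / (d - a) * ((c - b) / (d - a)) - 1 =
      -((c - b) / (d - a) * ((c - b) / (d - a))) by ring, norm_neg, norm_mul, norm_one]
    exact mul_lt_one_of_nonneg_of_lt_one_left (norm_nonneg _) hq hq.le
  by_cases h2 : ‖d - a‖ ≤ ‖b‖ ∧ b ≠ 0
  · refine ⟨(a - d) / b, 1, 0, ?_, by simp, by simp, by simp, by field_simp [h2.2]; ring⟩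
    rw [norm_div, div_le_one (norm_pos_iff.2 h2.2), norm_sub_rev]
    exact h2.1
  by_cases h3 : ‖d - a‖ ≤ ‖c‖ ∧ c ≠ 0
  · refine ⟨0, 1, (d - a) / c, by simp, by simp, ?_, by simp, by field_simp [h3.2]; ring⟩
    rw [norm_div, div_le_one (norm_pos_iff.2 h3.2)]
    exact h3.1
  have hda : ‖d - a‖ ≤ ‖b‖ ∨ ‖d - a‖ ≤ ‖c‖ := by
    by_contra! h
    exact h1 h
  have hb : b = 0 := by
    by_contra hb
    rcases hda with h | h
    · exact h2 ⟨h, hb⟩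
    · have hc : c = 0 := by
        by_contra hc
        exact h3 ⟨h, hc⟩
      rw [hc, norm_zero] at h
      exact h2 ⟨h.trans (norm_nonneg _), hb⟩
  have hc : c = 0 := by
    by_contra hc
    rcases hda with h | h
    · rw [hb, norm_zero] at h
      exact h3 ⟨h.trans (norm_nonneg _), hc⟩
    · exact h3 ⟨h, hc⟩
  exact ⟨1, 0, 1, by simp, by simp, by simp, by simp, by rw [hb, hc]; ring⟩

theorem locSymm_one (h₁ h₂ : M2 F) : LocSymm 1 h₁ h₂ := by
  refine ⟨1, le_rfl, Filter.Eventually.of_forall fun p _ _ _ => ?_⟩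
  obtain ⟨g, hgt, hg, hd, h⟩ := exists_symm_mul_symm (p.1ᵀ * p.2)
  refine ⟨Dmat g, 1, sBound_dmat le_rfl hg hd, sBound_one le_rfl, ?_⟩
  rw [mul_one, one_eq_blk, cellPt_blk, Dmat, bdiag, blk_transpose, blk_mul, blk_transpose, blk_inj]
  simp only [Matrix.transpose_mul, Matrix.transpose_transpose, hgt, mul_assoc] at h
  simp [hgt, mul_assoc, h]

end IdentityCell

section TwoByTwo

theorem fin_two_inj {R : Type*} {a b c d a' b' c' d' : R} :
    !![a, b; c, d] = !![a', b'; c', d'] ↔ (a = a' ∧ b = b') ∧ c = c' ∧ d = d' := by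
  simp

variable {F : Type*} [Field F]

theorem zero_fin_two : (0 : M2 F) = !![0, 0; 0, 0] := by
  ext i j
  fin_cases i <;> fin_cases j <;> rfl

theorem add_fin_two (a b c d a' b' c' d' : F) :
    (!![a, b; c, d] : M2 F) + !![a', b'; c', d'] = !![a + a', b + b'; c + c', d + d'] := by
  simp

theorem neg_fin_two (a b c d : F) : -(!![a, b; c, d] : M2 F) = !![-a, -b; -c, -d] := by
  simp

theorem smul_fin_two (x a b c d : F) :
    x • (!![a, b; c, d] : M2 F) = !![x * a, x * b; x * c, x * d] := by
  simp

theorem trace_mul_fin_two (a b c d : F) (h : M2 F) :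
    (!![a, b; c, d] * h).trace = a * h 0 0 + b * h 1 0 + c * h 0 1 + d * h 1 1 := by
  rw [Matrix.eta_fin_two h, Matrix.mul_fin_two, Matrix.trace_fin_two_of]
  simp
  ring

end TwoByTwo

section Representatives

variable {F : Type*} [Field F]

theorem bmat_eq_blk : (bmat : M6 F) = blk ![![!![1, 0; 0, 0], !![0, 0; 1, 0], 0],
    ![!![0, -1; 0, 0], 0, !![0, 0; 1, 0]], ![0, !![0, -1; 0, 0], !![0, 0; 0, 1]]] := by
  ext i j
  fin_cases i <;> fin_cases j <;> rfl

theorem bcb_eq_blk : (bmat * cmat * bmat : M6 F) = blk ![![!![1, 0; 0, 0], 0, !![0, 0; -1, 0]],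
    ![0, -1, 0], ![!![0, 1; 0, 0], 0, !![0, 0; 0, 1]]] := by
  simp only [bmat_eq_blk, cmat, bdiag, blk_mul, blk_inj, Jmat, zero_fin_two, Matrix.one_fin_two,
    Matrix.mul_fin_two, add_fin_two, neg_fin_two, fin_two_inj]
  simp

theorem bacb_eq_blk : (bmat * amat * cmat * bmat : M6 F) =
    blk ![![0, !![-1, 0; 0, 0], !![0, 0; -1, 0]],
      ![!![-1, 0; 0, 0], 0, !![0, 0; 0, -1]], ![!![0, 1; 0, 0], !![0, 0; 0, -1], 0]] := by
  simp only [bmat_eq_blk, cmat, amat, bdiag, blk_mul, blk_inj, Jmat, zero_fin_two,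
    Matrix.one_fin_two, Matrix.mul_fin_two, add_fin_two, fin_two_inj]
  simp

theorem bcabacb_eq_blk : (bmat * cmat * amat * bmat * amat * cmat * bmat : M6 F) =
    blk ![![0, 0, 1], ![0, 1, 0], ![1, 0, 0]] := by
  simp only [bmat_eq_blk, cmat, amat, bdiag, blk_mul, blk_inj, Jmat,
    zero_fin_two, Matrix.one_fin_two, Matrix.mul_fin_two, add_fin_two, fin_two_inj]
  simp

theorem bmat_transpose_mem_cell :
    (bmat : M6 F)ᵀ ∈ setT (Q3 F) * {bmat} * Q3 F := by
  refine transpose_mem_cell (d := etaMat (-1)) (etaMat_mem_Q3 (by simp [Matrix.det_neg])) ?_ ?_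
  · rw [etaMat, bdiag, blk_transpose, blk_inj]
    simp
  · simp only [bmat_eq_blk, etaMat, bdiag, blk_transpose, blk_mul, blk_inj, zero_fin_two,
      Matrix.one_fin_two, Matrix.mul_fin_two, add_fin_two, neg_fin_two, transpose_of_fin_two,
      smul_fin_two, fin_two_inj, Matrix.det_fin_two_of]
    simp

theorem dmat_diag_mem_Q3 : Dmat !![1, 0; 0, -1] ∈ Q3 F :=
  sgrp_subset_Q3 (dmat_mem_Sgrp (by simp))

theorem dmat_diag_transpose : (Dmat !![1, 0; 0, -1] : M6 F)ᵀ = Dmat !![1, 0; 0, -1] := by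
  rw [Dmat, bdiag, blk_transpose, transpose_of_fin_two]
  simp

theorem bcb_transpose_mem_cell :
    (bmat * cmat * bmat : M6 F)ᵀ ∈ setT (Q3 F) * {bmat * cmat * bmat} * Q3 F := by
  refine transpose_mem_cell dmat_diag_mem_Q3 dmat_diag_transpose ?_
  simp only [bcb_eq_blk, Dmat, bdiag, blk_transpose, blk_mul, blk_inj, zero_fin_two,
    Matrix.one_fin_two, Matrix.mul_fin_two, add_fin_two, neg_fin_two, transpose_of_fin_two,
    fin_two_inj]
  simp

theorem bacb_transpose_mem_cell :
    (bmat * amat * cmat * bmat : M6 F)ᵀ ∈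
      setT (Q3 F) * {bmat * amat * cmat * bmat} * Q3 F := by
  refine transpose_mem_cell dmat_diag_mem_Q3 dmat_diag_transpose ?_
  simp only [bacb_eq_blk, Dmat, bdiag, blk_transpose, blk_mul, blk_inj, zero_fin_two,
    Matrix.mul_fin_two, add_fin_two, transpose_of_fin_two, fin_two_inj]
  simp

theorem bcabacb_transpose_mem_cell :
    (bmat * cmat * amat * bmat * amat * cmat * bmat : M6 F)ᵀ ∈
      setT (Q3 F) * {bmat * cmat * amat * bmat * amat * cmat * bmat} * Q3 F := by
  refine transpose_mem_cell one_mem_Q3 (by simp) ?_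
  rw [bcabacb_eq_blk, blk_transpose]
  simp

end Representatives

section Conditions

variable {F : Type*} [Field F] {h₁ h₂ : M2 F}

theorem cond_of_good_bmat (h : Good bmat h₁ h₂) : h₁ 0 1 + h₂ 0 1 = 0 := by
  have := h !![0, 0; 1, 0] 0 !![0, 0; 1, 0] 0 ⟨by simp, by simp, by simp, by simp, fun c => by
    simp only [bmat_eq_blk, Umat, blk_transpose, blk_mul, blk_inj, zero_fin_two,
      Matrix.one_fin_two, Matrix.mul_fin_two, add_fin_two, neg_fin_two, transpose_of_fin_two,
      smul_fin_two, fin_two_inj, Matrix.adjugate_fin_two_of]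
    simp⟩
  simp only [trace_mul_fin_two] at this
  linear_combination this

theorem cond_of_good_bcb (h : Good (bmat * cmat * bmat) h₁ h₂) :
    h₂ 0 1 = h₁ 1 1 ∧ h₂ 1 1 = -h₁ 0 1 := by
  constructor
  · have := h !![0, 0; 0, -1] 0 !![0, 0; 1, 0] 0 ⟨by simp, by simp, by simp, by simp, fun c => by
      simp only [bcb_eq_blk, Umat, blk_transpose, blk_mul, blk_inj, zero_fin_two,
        Matrix.one_fin_two, Matrix.mul_fin_two, add_fin_two, neg_fin_two, transpose_of_fin_two,
        smul_fin_two, fin_two_inj, Matrix.adjugate_fin_two_of]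
      simp⟩
    simp only [trace_mul_fin_two] at this
    linear_combination this
  · have := h !![0, 0; 1, 0] 0 !![0, 0; 0, 1] 0 ⟨by simp, by simp, by simp, by simp, fun c => by
      simp only [bcb_eq_blk, Umat, blk_transpose, blk_mul, blk_inj, zero_fin_two,
        Matrix.one_fin_two, Matrix.mul_fin_two, add_fin_two, neg_fin_two, transpose_of_fin_two,
        smul_fin_two, fin_two_inj, Matrix.adjugate_fin_two_of]
      simp⟩
    simp only [trace_mul_fin_two] at this
    linear_combination this

theorem cond_of_good_bacb (h : Good (bmat * amat * cmat * bmat) h₁ h₂) :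
    h₁ 0 1 = 0 ∧ h₂ 0 1 = 0 ∧ h₁ 0 0 = h₂ 0 0 := by
  refine ⟨?_, ?_, ?_⟩
  · have := h !![0, 0; -1, 0] 0 0 !![1, 0; 0, -1]
      ⟨by simp, by simp, by simp [Matrix.trace_fin_two], by simp, fun c => by
      simp only [bacb_eq_blk, Umat, blk_transpose, blk_mul, blk_inj, zero_fin_two,
        Matrix.one_fin_two, Matrix.mul_fin_two, add_fin_two, neg_fin_two, transpose_of_fin_two,
        smul_fin_two, fin_two_inj, Matrix.adjugate_fin_two_of]
      simp⟩
    simp only [trace_mul_fin_two, zero_mul, Matrix.trace_zero] at this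
    linear_combination -this
  · have := h 0 !![1, 0; 0, -1] !![0, 0; 1, 0] 0
      ⟨by simp [Matrix.trace_fin_two], by simp, by simp, by simp, fun c => by
      simp only [bacb_eq_blk, Umat, blk_transpose, blk_mul, blk_inj, zero_fin_two,
        Matrix.one_fin_two, Matrix.mul_fin_two, add_fin_two, neg_fin_two, transpose_of_fin_two,
        smul_fin_two, fin_two_inj, Matrix.adjugate_fin_two_of]
      simp⟩
    simp only [trace_mul_fin_two, zero_mul, Matrix.trace_zero] at this
    linear_combination this
  · have := h !![-1, 0; 0, 0] 0 !![1, 0; 0, 0] 0 ⟨by simp, by simp, by simp, by simp, fun c => by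
      simp only [bacb_eq_blk, Umat, blk_transpose, blk_mul, blk_inj, zero_fin_two,
        Matrix.one_fin_two, Matrix.mul_fin_two, add_fin_two, neg_fin_two, transpose_of_fin_two,
        smul_fin_two, fin_two_inj, Matrix.adjugate_fin_two_of]
      simp⟩
    simp only [trace_mul_fin_two] at this
    linear_combination -this

theorem cond_of_good_bcabacb
    (h : Good (bmat * cmat * amat * bmat * amat * cmat * bmat) h₁ h₂) :
    h₁ = -h₂.adjugateᵀ := by
  have key : ∀ a b c d : F, a * d - b * c = 0 →
      (!![d, -c; -b, a] * h₁).trace + (!![a, b; c, d] * h₂).trace = 0 := by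
    intro a b c d h0
    refine h _ 0 _ 0 ⟨by simp, ?_, by simp, ?_, fun x => ?_⟩
    · rw [Matrix.det_fin_two_of]
      linear_combination h0
    · rw [Matrix.det_fin_two_of, h0]
    · simp only [bcabacb_eq_blk, Umat, blk_transpose, blk_mul, blk_inj, zero_fin_two,
        Matrix.one_fin_two, Matrix.mul_fin_two, add_fin_two, neg_fin_two, transpose_of_fin_two,
        smul_fin_two, fin_two_inj, Matrix.adjugate_fin_two_of]
      simp
      refine ⟨⟨?_, ?_⟩, ?_, ?_⟩
      · linear_combination x ^ 2 * h0
      · ring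
      · ring
      · linear_combination x ^ 2 * h0
  have e₁ := key 1 0 0 0 (by simp)
  have e₂ := key 0 1 0 0 (by simp)
  have e₃ := key 0 0 1 0 (by simp)
  have e₄ := key 0 0 0 1 (by simp)
  obtain ⟨a, b, c, d, rfl⟩ := exists_eq_fin_two h₁
  obtain ⟨a', b', c', d', rfl⟩ := exists_eq_fin_two h₂
  simp only [Matrix.mul_fin_two, Matrix.trace_fin_two_of] at e₁ e₂ e₃ e₄
  rw [Matrix.adjugate_fin_two_of, transpose_of_fin_two, neg_fin_two, fin_two_inj]
  refine ⟨⟨?_, ?_⟩, ?_, ?_⟩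
  · linear_combination e₄
  · linear_combination -e₂
  · linear_combination -e₃
  · linear_combination e₁

end Conditions

section LongCell

variable {F : Type*} [NontriviallyNormedField F]

theorem locSymm_bcabacb (h₁ h₂ : M2 F) :
    LocSymm (bmat * cmat * amat * bmat * amat * cmat * bmat) h₁ h₂ := by
  refine ⟨1, le_rfl, Filter.Eventually.of_forall fun p _ _ hg => ?_⟩
  refine ⟨1, 1, sBound_one le_rfl, sBound_one le_rfl, ?_⟩
  have h := cond_of_good_bcabacb hg
  have hd : p.1.det = p.2.det := by
    rw [h, Matrix.det_neg, Matrix.det_transpose, Matrix.det_adjugate]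
    simp
  have hm : p.1ᵀ * p.2 = -(p.2.det • 1) := by
    rw [h, Matrix.transpose_neg, Matrix.transpose_transpose, neg_mul, Matrix.adjugate_mul]
  rw [Matrix.transpose_one, one_mul, mul_one, bcabacb_eq_blk, cellPt_blk, blk_transpose, blk_inj]
  simp [hd, hm]

end LongCell

section BcbCell

theorem cellPt_bcb {F : Type*} [Field F] (h₁ h₂ : M2 F) :
    cellPt (bmat * cmat * bmat) h₁ h₂ = blk ![![!![1, 0; 0, 0], 0, !![0, 0; -h₂.det, 0]],
      ![0, -(h₁ᵀ * h₂), 0], ![!![0, h₁.det; 0, 0], 0, !![0, 0; 0, h₁.det * h₂.det]]] := by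
  rw [bcb_eq_blk, cellPt_blk, blk_inj]
  simp

theorem transpose_mul_of_good_bcb {F : Type*} [Field F] {h₁ h₂ : M2 F}
    (h : Good (bmat * cmat * bmat) h₁ h₂) :
    ∃ x, h₁ᵀ * h₂ = !![x, h₁.det; -h₂.det, 0] := by
  obtain ⟨h, h'⟩ := cond_of_good_bcb h
  obtain ⟨a, b, c, d, rfl⟩ := exists_eq_fin_two h₁
  obtain ⟨a', b', c', d', rfl⟩ := exists_eq_fin_two h₂
  simp only [Matrix.of_apply, Matrix.cons_val_zero, Matrix.cons_val_one, Matrix.cons_val'] at h h'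
  subst h h'
  refine ⟨a * a' + c * c', ?_⟩
  rw [transpose_of_fin_two, Matrix.mul_fin_two, fin_two_inj, Matrix.det_fin_two_of,
    Matrix.det_fin_two_of]
  refine ⟨⟨?_, ?_⟩, ?_, ?_⟩ <;> ring

theorem translate_bcb {F : Type*} [Field F] {h₁ h₂ : M2 F} (hd₁ : h₁.det ≠ 0)
    (hd₂ : h₂.det ≠ 0) (h : Good (bmat * cmat * bmat) h₁ h₂) :
    ∃ k₁ k₂ : M2 F, k₁.det ≠ 0 ∧ k₂.det = k₁.det ∧
      Translate (cellPt (bmat * cmat * bmat) h₁ h₂) (cellPt (bmat * cmat * bmat) k₁ k₂) := by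
  obtain ⟨x, hx⟩ := transpose_mul_of_good_bcb h
  refine ⟨!![x, -h₁.det; 1, 0], !![1, 0; 0, h₁.det], by simpa using hd₁, by simp,
    translate_of_dmat (g := !![1, 0; 0, h₂.det / h₁.det]) (by simp [hd₁, hd₂]) ?_⟩
  rw [cellPt_bcb, cellPt_bcb, hx]
  simp only [Dmat, bdiag, blk_mul, blk_inj, zero_fin_two, Matrix.mul_fin_two,
    add_fin_two, neg_fin_two, transpose_of_fin_two, fin_two_inj, Matrix.det_fin_two_of]
  simp
  field_simp
  simp

variable {F : Type*} [NontriviallyNormedField F] [IsUltrametricDist F]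

theorem locSymm_bcb {h₁ h₂ : M2 F} (hd₁ : h₁.det ≠ 0) (hd : ‖h₂.det‖ = ‖h₁.det‖) :
    LocSymm (bmat * cmat * bmat) h₁ h₂ := by
  refine locSymm_of (Z₁ := fun _ => 0) (Z₂ := fun _ => 0) (β₁ := fun _ => 1)
    (β₂ := fun p => -p.2.det / p.1.det) continuousAt_const continuousAt_const (fun _ => by simp)
    (fun _ => by simp) continuousAt_const
    (continuous_snd.matrix_det.neg.continuousAt.div continuous_fst.matrix_det.continuousAt hd₁)
    norm_one ?_ ?_
  · rw [norm_div, norm_neg, hd, div_self (norm_ne_zero_iff.2 hd₁)]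
  intro p hp₁ hp₂ _ _ hg
  obtain ⟨x, hx⟩ := transpose_mul_of_good_bcb hg
  rw [cellPt_bcb, hx]
  simp only [Dmat, Umat, bdiag, blk_transpose, blk_mul, blk_inj, zero_fin_two, Matrix.mul_fin_two,
    Matrix.one_fin_two, add_fin_two, neg_fin_two, transpose_of_fin_two, fin_two_inj]
  simp
  field_simp
  simp

end BcbCell

section BacbCell

theorem cellPt_bacb {F : Type*} [Field F] (p v₁ w₁ v₂ w₂ : F) :
    cellPt (bmat * amat * cmat * bmat) !![p, 0; v₁, w₁] !![p, 0; v₂, w₂] =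
      blk ![![0, !![-p, 0; 0, 0], !![0, 0; -(p * w₂), 0]],
        ![!![-p, 0; 0, 0], 0, !![0, -(p * w₂ * v₁); 0, -(p * w₂ * w₁)]],
        ![!![0, p * w₁; 0, 0], !![0, 0; -(p * w₁ * v₂), -(p * w₁ * w₂)], 0]] := by
  rw [bacb_eq_blk, cellPt_blk]
  simp only [blk_inj, zero_fin_two, Matrix.mul_fin_two, transpose_of_fin_two, smul_fin_two,
    fin_two_inj, Matrix.det_fin_two_of]
  simp

theorem translate_bacb {F : Type*} [Field F] {h₁ h₂ : M2 F} (hd₁ : h₁.det ≠ 0)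
    (hd₂ : h₂.det ≠ 0) (h : Good (bmat * amat * cmat * bmat) h₁ h₂) :
    ∃ k₁ k₂ : M2 F, k₁.det ≠ 0 ∧ k₂.det = k₁.det ∧
      Translate (cellPt (bmat * amat * cmat * bmat) h₁ h₂)
        (cellPt (bmat * amat * cmat * bmat) k₁ k₂) := by
  obtain ⟨e₁, e₂, e₃⟩ := cond_of_good_bacb h
  obtain ⟨a, b, c, d, rfl⟩ := exists_eq_fin_two h₁
  obtain ⟨a', b', c', d', rfl⟩ := exists_eq_fin_two h₂
  simp only [Matrix.of_apply, Matrix.cons_val_zero, Matrix.cons_val_one,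
    Matrix.cons_val'] at e₁ e₂ e₃
  subst e₁ e₂ e₃
  rw [Matrix.det_fin_two_of, zero_mul, sub_zero, mul_ne_zero_iff] at hd₁ hd₂
  obtain ⟨ha, hd⟩ := hd₁
  have hd' := hd₂.2
  refine ⟨!![a, 0; d' / d * c, d], !![a, 0; d / d' * c', d], by simp [ha, hd], by simp,
    translate_of_dmat (g := !![1, 0; 0, d' / d]) (by simp [hd, hd']) ?_⟩
  rw [cellPt_bacb, cellPt_bacb]
  simp only [Dmat, bdiag, blk_mul, blk_inj, zero_fin_two, Matrix.mul_fin_two, add_fin_two,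
    fin_two_inj]
  simp
  field_simp
  simp

variable {F : Type*} [NontriviallyNormedField F] [IsUltrametricDist F]

theorem locSymm_bacb {h₁ h₂ : M2 F} (hd₁ : h₁.det ≠ 0) (hd : ‖h₂.det‖ = ‖h₁.det‖) :
    LocSymm (bmat * amat * cmat * bmat) h₁ h₂ := by
  have c₁ (i j : Fin 2) : Continuous fun p : M2 F × M2 F => p.1 i j :=
    continuous_fst.matrix_elem i j
  have c₂ (i j : Fin 2) : Continuous fun p : M2 F × M2 F => p.2 i j :=
    continuous_snd.matrix_elem i j
  have z₁ : Continuous fun p : M2 F × M2 F => (-p.1 1 1 * p.2 1 0) • (!![0, 1; 0, 0] : M2 F) :=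
    ((c₁ 1 1).neg.mul (c₂ 1 0)).smul continuous_const
  have z₂ : Continuous fun p : M2 F × M2 F => (-p.2 1 1 * p.1 1 0) • (!![0, 1; 0, 0] : M2 F) :=
    ((c₂ 1 1).neg.mul (c₁ 1 0)).smul continuous_const
  refine locSymm_of (β₁ := fun _ => 1) (β₂ := fun p => -p.2.det / p.1.det)
    z₁.continuousAt z₂.continuousAt
    (fun _ => by simp) (fun _ => by simp)
    continuousAt_const
    (continuous_snd.matrix_det.neg.continuousAt.div continuous_fst.matrix_det.continuousAt hd₁)
    norm_one ?_ ?_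
  · rw [norm_div, norm_neg, hd, div_self (norm_ne_zero_iff.2 hd₁)]
  rintro ⟨p₁, p₂⟩ hp₁ hp₂ _ _ hg
  obtain ⟨e₁, e₂, e₃⟩ := cond_of_good_bacb hg
  obtain ⟨a, b, c, d, rfl⟩ := exists_eq_fin_two p₁
  obtain ⟨a', b', c', d', rfl⟩ := exists_eq_fin_two p₂
  simp only [Matrix.of_apply, Matrix.cons_val_zero, Matrix.cons_val_one,
    Matrix.cons_val'] at e₁ e₂ e₃
  subst e₁ e₂ e₃
  simp only [Matrix.det_fin_two_of, zero_mul, sub_zero, mul_ne_zero_iff] at hp₁ hp₂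
  obtain ⟨ha, hd⟩ := hp₁
  have hd' := hp₂.2
  rw [cellPt_bacb]
  simp only [Dmat, Umat, bdiag, blk_transpose, blk_mul, blk_inj, zero_fin_two, Matrix.mul_fin_two,
    Matrix.one_fin_two, add_fin_two, transpose_of_fin_two, fin_two_inj, smul_fin_two,
    Matrix.det_fin_two_of]
  simp
  field_simp
  simp

end BacbCell

section BmatCell

theorem cellPt_bmat {F : Type*} [Field F] (r s t u p q v w : F) :
    cellPt bmat !![r, s; t, u] !![p, q; v, w] =
      blk ![![!![1, 0; 0, 0], !![0, 0; p, q], 0],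
        ![!![0, -r; 0, -s], 0, !![(p * w - q * v) * t, 0; (p * w - q * v) * u, 0]],
        ![0, !![-((r * u - s * t) * v), -((r * u - s * t) * w); 0, 0],
          !![0, 0; 0, (r * u - s * t) * (p * w - q * v)]]] := by
  rw [bmat_eq_blk, cellPt_blk]
  simp only [blk_inj, zero_fin_two, Matrix.mul_fin_two, transpose_of_fin_two, smul_fin_two,
    fin_two_inj, Matrix.det_fin_two_of]
  simp

theorem cellPt_bmat_transpose {F : Type*} [Field F] (h₁ h₂ : M2 F) :
    (cellPt bmat h₁ h₂)ᵀ = cellPt bmat (-h₂) (-h₁) := by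
  obtain ⟨r, s, t, u, rfl⟩ := exists_eq_fin_two h₁
  obtain ⟨p, q, v, w, rfl⟩ := exists_eq_fin_two h₂
  rw [neg_fin_two, neg_fin_two, cellPt_bmat, cellPt_bmat]
  simp only [blk_transpose, blk_inj, zero_fin_two, transpose_of_fin_two, fin_two_inj]
  simp [mul_comm]

theorem translate_bmat_mul {F : Type*} [Field F] (h₁ h₂ : M2 F) (γ : F) :
    Translate (cellPt bmat h₁ (h₂ * !![1, 0; γ, 1])) (cellPt bmat h₁ h₂) := by
  obtain ⟨r, s, t, u, rfl⟩ := exists_eq_fin_two h₁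
  obtain ⟨p, q, v, w, rfl⟩ := exists_eq_fin_two h₂
  refine ⟨Umat !![γ * r, γ * s; 0, 0] (-(!![γ * r, γ * s; 0, 0] : M2 F).adjugate) 0,
    Dmat !![1, 0; γ, 1], umat_mem_Sgrp (by simp), dmat_mem_Sgrp (by simp), ?_⟩
  rw [Matrix.mul_fin_two, cellPt_bmat, cellPt_bmat]
  simp only [Dmat, Umat, bdiag, blk_transpose, blk_mul, blk_inj, zero_fin_two, Matrix.mul_fin_two,
    Matrix.one_fin_two, add_fin_two, neg_fin_two, transpose_of_fin_two, fin_two_inj,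
    Matrix.adjugate_fin_two_of]
  simp
  ring_nf
  simp

theorem exists_translate_bmat {F : Type*} [Field F] (h₁ : M2 F) {h₂ : M2 F} (hd : h₂.det ≠ 0) :
    ∃ k : M2 F, k.det ≠ 0 ∧ k 0 0 ≠ 0 ∧ Translate (cellPt bmat h₁ h₂) (cellPt bmat h₁ k) := by
  by_cases h : h₂ 0 0 = 0
  · refine ⟨h₂ * !![1, 0; 1, 1], by simpa using hd, ?_, ?_⟩
    · intro h'
      rw [Matrix.det_fin_two] at hd
      simp [Matrix.mul_apply, Fin.sum_univ_two, h] at h'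
      simp [h, h'] at hd
    · have := translate_bmat_mul h₁ (h₂ * !![1, 0; 1, 1]) (-1)
      rwa [mul_assoc, Matrix.mul_fin_two, show (!![1 * 1 + 0 * -1, 1 * 0 + 0 * 1;
        1 * 1 + 1 * -1, 1 * 0 + 1 * 1] : M2 F) = 1 by simp [Matrix.one_fin_two], mul_one] at this
  · exact ⟨h₂, hd, h, Translate.refl _⟩

theorem translate_bmat {F : Type*} [Field F] {h₁ h₂ : M2 F} (hd₁ : h₁.det ≠ 0)
    (hd₂ : h₂.det ≠ 0) :
    ∃ k₁ k₂ : M2 F, k₁.det ≠ 0 ∧ k₂.det ≠ 0 ∧ k₁ 0 0 ≠ 0 ∧ k₂ 0 0 = k₁ 0 0 ∧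
      Translate (cellPt bmat h₁ h₂) (cellPt bmat k₁ k₂) := by
  obtain ⟨l₂, ld₂, lz₂, hl₂⟩ := exists_translate_bmat h₁ hd₂
  obtain ⟨l₁, ld₁, lz₁, hl₁⟩ := exists_translate_bmat (-l₂) (h₂ := -h₁) (by simpa [Matrix.det_neg])
  have hl := hl₁.transpose
  rw [cellPt_bmat_transpose, cellPt_bmat_transpose, neg_neg, neg_neg] at hl
  suffices H : ∃ k₁ k₂ : M2 F, k₁.det ≠ 0 ∧ k₂.det ≠ 0 ∧ k₁ 0 0 ≠ 0 ∧ k₂ 0 0 = k₁ 0 0 ∧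
      Translate (cellPt bmat (-l₁) l₂) (cellPt bmat k₁ k₂) by
    obtain ⟨k₁, k₂, a, b, c, d, e⟩ := H
    exact ⟨k₁, k₂, a, b, c, d, hl₂.trans (hl.trans e)⟩
  obtain ⟨r, s, t, u, e₁⟩ := exists_eq_fin_two (-l₁)
  obtain ⟨p, q, v, w, rfl⟩ := exists_eq_fin_two l₂
  have hr : r ≠ 0 := by
    have := congrArg (fun m => m 0 0) e₁
    intro h0
    simp [h0] at this
    exact lz₁ this
  have hp : p ≠ 0 := by simpa using lz₂
  have hd : r * u - s * t ≠ 0 := by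
    rw [← Matrix.det_fin_two_of, ← e₁]
    simpa [Matrix.det_neg] using ld₁
  rw [Matrix.det_fin_two_of] at ld₂
  have hd' : r / p * p * w - r / p * q * v ≠ 0 := by
    rw [show r / p * p * w - r / p * q * v = r / p * (p * w - q * v) by ring]
    exact mul_ne_zero (div_ne_zero hr hp) ld₂
  have hd'' : r * u - r / p * s * (p / r * t) ≠ 0 := by
    rwa [show r * u - r / p * s * (p / r * t) = r * u - s * t by field_simp]
  refine ⟨!![r, r / p * s; p / r * t, u], !![r / p * p, r / p * q; v, w],
    by rwa [Matrix.det_fin_two_of], by rwa [Matrix.det_fin_two_of], hr,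
    by simp [hp],
    translate_of_dmat (g := !![1, 0; 0, p / r]) (by simp [hr, hp]) ?_⟩
  rw [e₁, cellPt_bmat, cellPt_bmat]
  simp only [Dmat, bdiag, blk_mul, blk_inj, zero_fin_two, Matrix.mul_fin_two, add_fin_two,
    fin_two_inj]
  simp
  field_simp
  simp

variable {F : Type*} [NontriviallyNormedField F] [IsUltrametricDist F]

theorem locSymm_bmat {h₁ h₂ : M2 F} (h0 : h₁ 0 0 ≠ 0) (h : h₂ 0 0 = h₁ 0 0) :
    LocSymm bmat h₁ h₂ := by
  have hh : h₂ 0 0 ≠ 0 := by rwa [h]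
  have c₁ (i j : Fin 2) : ContinuousAt (fun p : M2 F × M2 F => p.1 i j) (h₁, h₂) :=
    (continuous_fst.matrix_elem i j).continuousAt
  have c₂ (i j : Fin 2) : ContinuousAt (fun p : M2 F × M2 F => p.2 i j) (h₁, h₂) :=
    (continuous_snd.matrix_elem i j).continuousAt
  have z₁ : ContinuousAt (fun p : M2 F × M2 F =>
      (p.1.det * p.2 1 0 / p.2 0 0) • (!![0, 0; 1, 0] : M2 F)) (h₁, h₂) :=
    ((continuous_fst.matrix_det.continuousAt.mul (c₂ 1 0)).div (c₂ 0 0) hh).smul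
      continuousAt_const
  have z₂ : ContinuousAt (fun p : M2 F × M2 F =>
      (p.2.det * p.1 1 0 / p.1 0 0) • (!![0, 0; 1, 0] : M2 F)) (h₁, h₂) :=
    ((continuous_snd.matrix_det.continuousAt.mul (c₁ 1 0)).div (c₁ 0 0) h0).smul
      continuousAt_const
  refine locSymm_of (β₁ := fun p => -p.1 0 0 / p.2 0 0) (β₂ := fun _ => 1) z₁ z₂
    (fun _ => by simp) (fun _ => by simp) ((c₁ 0 0).neg.div (c₂ 0 0) hh) continuousAt_const
    ?_ norm_one ?_
  · change ‖-h₁ 0 0 / h₂ 0 0‖ = 1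
    rw [h, norm_div, norm_neg, div_self (norm_ne_zero_iff.2 h0)]
  rintro ⟨p₁, p₂⟩ - - hb - hg
  have hs := cond_of_good_bmat hg
  obtain ⟨r, s, t, u, rfl⟩ := exists_eq_fin_two p₁
  obtain ⟨p, q, v, w, rfl⟩ := exists_eq_fin_two p₂
  simp only [Matrix.of_apply, Matrix.cons_val_zero, Matrix.cons_val_one, Matrix.cons_val'] at hs hb
  rw [div_ne_zero_iff, neg_ne_zero] at hb
  obtain ⟨hr, hp⟩ := hb
  obtain rfl : s = -q := by linear_combination hs
  rw [cellPt_bmat]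
  simp only [Dmat, Umat, bdiag, blk_transpose, blk_mul, blk_inj, zero_fin_two, Matrix.mul_fin_two,
    Matrix.one_fin_two, add_fin_two, transpose_of_fin_two, fin_two_inj, smul_fin_two,
    Matrix.det_fin_two_of]
  simp
  field_simp
  ring_nf
  simp

end BmatCell

theorem isUltrametricDist_of_padic (p : ℕ) [Fact p.Prime] (K : Type*) [NontriviallyNormedField K]
    [NormedAlgebra ℚ_[p] K] : IsUltrametricDist K := by
  refine IsUltrametricDist.isUltrametricDist_of_forall_norm_natCast_le_one fun n => ?_
  rw [← map_natCast (algebraMap ℚ_[p] K) n, norm_algebraMap']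
  exact IsUltrametricDist.norm_natCast_le_one ℚ_[p] n

/-- Main distribution theorem.  Let `σ ∈ Σ` and let `R = Q3ᵀ·σ·Q3`.  Then
every `(S,ψ,T)`-invariant distribution `T` on `R` is transpose-invariant:
`T(x ↦ f(xᵀ)) = T(f)` for all `f ∈ C_c^∞(R)`. -/
theorem invariant_distribution_transpose_invariant
    {p : ℕ} [Fact p.Prime] {k : Type*} [NontriviallyNormedField k]
    [NormedAlgebra ℚ_[p] k] [FiniteDimensional ℚ_[p] k]
    (ψk : k → ℂˣ) (hψk : ∀ x y : k, ψk (x + y) = ψk x * ψk y)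
    (hnt : ∃ x : k, ψk x ≠ 1) (hlc : IsLocallyConstant ψk)
    (ψS : M6 k → ℂˣ) (hψS : IsShalikaCharacter ψk ψS)
    (σ : M6 k) (hσ : σ ∈ SigmaSet k)
    (R : Set (M6 k)) (hR : R = setT (Q3 k) * {σ} * Q3 k)
    (T : ({m : M6 k // m ∈ R} → ℂ) → ℂ) (hT : IsInvariantDistrib ψS R T) :
    ∀ f ∈ Cc R, ∀ f' ∈ Cc R,
      (∀ (x : M6 k) (hx : x ∈ R) (hx' : xᵀ ∈ R), f' ⟨x, hx⟩ = f ⟨xᵀ, hx'⟩) →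
      T f' = T f := by
  subst hR
  intro f hf f' _ hff
  have : IsUltrametricDist k := isUltrametricDist_of_padic p k
  have : ProperSpace k := FiniteDimensional.proper ℚ_[p] k
  simp only [SigmaSet, Set.mem_insert_iff, Set.mem_singleton_iff] at hσ
  rcases hσ with rfl | rfl | rfl | rfl | rfl
  · refine hT.transpose_eq hψk hlc hnt hψS one_transpose_mem_cell
      (fun h₁ h₂ hd₁ hd₂ _ => ?_) hf (fun x => hff x.1 x.2 _)
    obtain ⟨a, b, ha, hb, h⟩ := Translate.refl (cellPt 1 h₁ h₂)
    exact ⟨h₁, h₂, a, b, hd₁, hd₂, ha, hb, h, locSymm_one h₁ h₂⟩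
  · refine hT.transpose_eq hψk hlc hnt hψS bmat_transpose_mem_cell
      (fun h₁ h₂ hd₁ hd₂ _ => ?_) hf (fun x => hff x.1 x.2 _)
    obtain ⟨k₁, k₂, e₁, e₂, h0, hk, a, b, ha, hb, h⟩ := translate_bmat hd₁ hd₂
    exact ⟨k₁, k₂, a, b, e₁, e₂, ha, hb, h, locSymm_bmat h0 hk⟩
  · refine hT.transpose_eq hψk hlc hnt hψS bcb_transpose_mem_cell
      (fun h₁ h₂ hd₁ hd₂ hg => ?_) hf (fun x => hff x.1 x.2 _)
    obtain ⟨k₁, k₂, e₁, e₂, a, b, ha, hb, h⟩ := translate_bcb hd₁ hd₂ hg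
    exact ⟨k₁, k₂, a, b, e₁, by rwa [e₂], ha, hb, h, locSymm_bcb e₁ (by rw [e₂])⟩
  · refine hT.transpose_eq hψk hlc hnt hψS bacb_transpose_mem_cell
      (fun h₁ h₂ hd₁ hd₂ hg => ?_) hf (fun x => hff x.1 x.2 _)
    obtain ⟨k₁, k₂, e₁, e₂, a, b, ha, hb, h⟩ := translate_bacb hd₁ hd₂ hg
    exact ⟨k₁, k₂, a, b, e₁, by rwa [e₂], ha, hb, h, locSymm_bacb e₁ (by rw [e₂])⟩
  · refine hT.transpose_eq hψk hlc hnt hψS bcabacb_transpose_mem_cell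
      (fun h₁ h₂ hd₁ hd₂ _ => ?_) hf (fun x => hff x.1 x.2 _)
    obtain ⟨a, b, ha, hb, h⟩ := Translate.refl
      (cellPt (bmat * cmat * amat * bmat * amat * cmat * bmat) h₁ h₂)
    exact ⟨h₁, h₂, a, b, hd₁, hd₂, ha, hb, h, locSymm_bcabacb h₁ h₂⟩
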